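/- For every unimodular lattice x in ℝⁿ (n ≥ 2), the closure of the orbit A·x in the space of unimodular lattices contains a stable lattice. -/

import Mathlib

open scoped BigOperators
open Matrix Topology Filter

noncomputable section

namespace SW

/-! ### Euclidean structure on `Fin n → ℝ` -/

/-- The standard Euclidean inner product on `Fin n → ℝ`. -/
def einner {n : ℕ} (v w : Fin n → ℝ) : ℝ := ∑ i, v i * w i

/-- The Euclidean norm on `Fin n → ℝ`. -/
def enorm {n : ℕ} (v : Fin n → ℝ) : ℝ := Real.sqrt (∑ i, v i ^ 2)

lemma einner_add_left {n : ℕ} (u v w : Fin n → ℝ) :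
    einner (u + v) w = einner u w + einner v w := by
  simp [einner, add_mul, Finset.sum_add_distrib]

lemma einner_neg_left {n : ℕ} (u w : Fin n → ℝ) : einner (-u) w = -einner u w := by
  simp [einner]

lemma einner_smul_left {n : ℕ} (c : ℝ) (u w : Fin n → ℝ) :
    einner (c • u) w = c * einner u w := by
  simp [einner, Finset.mul_sum, mul_assoc]

/-! ### Covolume, rank, lattices, stability -/

/-- `√(det Gram)` of a finite family of vectors: the covolume of the ℤ-span of the family
(in the span of the family) when the family is linearly independent. -/
def gvol {n r : ℕ} (v : Fin r → (Fin n → ℝ)) : ℝ :=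
  Real.sqrt (Matrix.det (Matrix.of fun i j => einner (v i) (v j)))

/-- `c` is the covolume of `Λ` in its real span, as computed from some ℤ-basis of `Λ` which is
linearly independent over `ℝ`. -/
def covolSpec {n : ℕ} (Λ : AddSubgroup (Fin n → ℝ)) (c : ℝ) : Prop :=
  ∃ (r : ℕ) (v : Fin r → (Fin n → ℝ)), LinearIndependent ℝ v ∧
    Λ = AddSubgroup.closure (Set.range v) ∧ c = gvol v

/-- The covolume of a discrete subgroup `Λ ⊆ ℝⁿ` inside its real span (with `covol ⊥ = 1`). -/
def covol {n : ℕ} (Λ : AddSubgroup (Fin n → ℝ)) : ℝ := sInf {c | covolSpec Λ c}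

/-- The rank of a discrete subgroup of `ℝⁿ`: the dimension of its real span. -/
def rk {n : ℕ} (Λ : AddSubgroup (Fin n → ℝ)) : ℕ :=
  Module.finrank ℝ (Submodule.span ℝ (Λ : Set (Fin n → ℝ)))

/-- A lattice in `ℝⁿ`: a discrete subgroup spanning `ℝⁿ` (equivalently, cocompact). -/
def IsLattice {n : ℕ} (L : AddSubgroup (Fin n → ℝ)) : Prop :=
  DiscreteTopology ↥L ∧ Submodule.span ℝ (L : Set (Fin n → ℝ)) = ⊤

/-- A unimodular lattice: a lattice of covolume one. -/
def IsUnimodularLattice {n : ℕ} (L : AddSubgroup (Fin n → ℝ)) : Prop :=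
  IsLattice L ∧ covol L = 1

/-- A stable lattice: a unimodular lattice all of whose subgroups have covolume at least one. -/
def IsStable {n : ℕ} (L : AddSubgroup (Fin n → ℝ)) : Prop :=
  IsUnimodularLattice L ∧ ∀ Λ : AddSubgroup (Fin n → ℝ), Λ ≤ L → 1 ≤ covol Λ

/-! ### Matrices: the diagonal group `A`, `SL_n(ℤ)`, lattices from matrices -/

/-- The group `A` of positive diagonal matrices of determinant one (as a set of matrices). -/
def Apos (n : ℕ) : Set (Matrix (Fin n) (Fin n) ℝ) :=
  {a | ∃ d : Fin n → ℝ, (∀ i, 0 < d i) ∧ (∏ i, d i) = 1 ∧ a = Matrix.diagonal d}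

/-- `SL_n(ℤ)` viewed as a set of real matrices. -/
def Gam (n : ℕ) : Set (Matrix (Fin n) (Fin n) ℝ) :=
  {γ | γ.det = 1 ∧ ∀ i j, ∃ m : ℤ, γ i j = (m : ℝ)}

/-- The lattice `g·ℤⁿ` associated to a matrix `g`. -/
def latticeOf {n : ℕ} (g : Matrix (Fin n) (Fin n) ℝ) : AddSubgroup (Fin n → ℝ) :=
  AddSubgroup.closure (Set.range fun m : Fin n → ℤ => g.mulVec fun i => (m i : ℝ))

/-- The image `g·L` of a lattice under a matrix. -/
def mapLat {n : ℕ} (g : Matrix (Fin n) (Fin n) ℝ) (L : AddSubgroup (Fin n → ℝ)) :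
    AddSubgroup (Fin n → ℝ) :=
  AddSubgroup.map (Matrix.mulVecLin g).toAddMonoidHom L

/-- The full preimage `A·g·Γ` in `SL_n(ℝ)` of the orbit `A·[g] ⊆ ℒ_n`; a point `[h] ∈ ℒ_n`
lies in the closure of `A·[g]` iff `h ∈ closure (AOrbit g)`. -/
def AOrbit {n : ℕ} (g : Matrix (Fin n) (Fin n) ℝ) : Set (Matrix (Fin n) (Fin n) ℝ) :=
  {p | ∃ a ∈ Apos n, ∃ γ ∈ Gam n, p = a * g * γ}

/-- The orbit `A·[g] ⊆ ℒ_n` is bounded (has compact closure). -/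
def HasBoundedAOrbit {n : ℕ} (g : Matrix (Fin n) (Fin n) ℝ) : Prop :=
  ∃ K : Set (Matrix (Fin n) (Fin n) ℝ), IsCompact K ∧
    ∀ a ∈ Apos n, ∃ γ ∈ Gam n, a * g * γ ∈ K

/-! ### `α`, `Min_δ`, `V_δ`, `dim_δ` -/

/-- `α(x) = min { |Λ|^{1/r(Λ)} : Λ a nonzero subgroup of x }`. -/
def alpha {n : ℕ} (x : AddSubgroup (Fin n → ℝ)) : ℝ :=
  sInf {c | ∃ Λ : AddSubgroup (Fin n → ℝ), Λ ≤ x ∧ Λ ≠ ⊥ ∧ c = covol Λ ^ ((rk Λ : ℝ)⁻¹)}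

/-- `α_k(x) = min { |Λ|^{1/k} : Λ a rank-`k` subgroup of x }`. -/
def alphak {n : ℕ} (k : ℕ) (x : AddSubgroup (Fin n → ℝ)) : ℝ :=
  sInf {c | ∃ Λ : AddSubgroup (Fin n → ℝ), Λ ≤ x ∧ rk Λ = k ∧ c = covol Λ ^ ((k : ℝ)⁻¹)}

/-- `Min_δ(x)`: nonzero subgroups nearly attaining `α(x)`. -/
def MinSet {n : ℕ} (δ : ℝ) (x : AddSubgroup (Fin n → ℝ)) : Set (AddSubgroup (Fin n → ℝ)) :=
  {Λ | Λ ≤ x ∧ Λ ≠ ⊥ ∧ covol Λ ^ ((rk Λ : ℝ)⁻¹) < (1 + δ) * alpha x}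

/-- `V_δ(x)`: the span of the subgroups in `Min_δ(x)`. -/
def Vdelta {n : ℕ} (δ : ℝ) (x : AddSubgroup (Fin n → ℝ)) : Submodule ℝ (Fin n → ℝ) :=
  Submodule.span ℝ (⋃ Λ ∈ MinSet δ x, (Λ : Set (Fin n → ℝ)))

/-- `dim_δ(x) = dim V_δ(x)`. -/
def dimdelta {n : ℕ} (δ : ℝ) (x : AddSubgroup (Fin n → ℝ)) : ℕ :=
  Module.finrank ℝ (Vdelta δ x)

/-- `U_k^{x,ε} ⊆ A`: those `a` for which `δ ↦ dim_δ(ax)` equals `k` near `kε`. -/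
def Uset {n : ℕ} (x : AddSubgroup (Fin n → ℝ)) (ε : ℝ) (k : ℕ) :
    Set (Matrix (Fin n) (Fin n) ℝ) :=
  {a | a ∈ Apos n ∧ ∃ s ∈ 𝓝 ((k : ℝ) * ε), ∀ δ ∈ s, dimdelta δ (mapLat a x) = k}

/-- Logarithmic coordinates on the diagonal group. -/
def logCoord {n : ℕ} (a : Matrix (Fin n) (Fin n) ℝ) : Fin n → ℝ := fun i => Real.log (a i i)

/-! ### Covering radius -/

/-- The covering radius `covrad(L) = sup_u inf_{v ∈ L} ‖u - v‖`. -/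
def covrad {n : ℕ} (L : AddSubgroup (Fin n → ℝ)) : ℝ :=
  ⨆ u : Fin n → ℝ, ⨅ v : L, enorm (u - (v : Fin n → ℝ))

/-- `[g]` is a local maximum of `covrad : ℒ_d → ℝ` (phrased via the open quotient
`SL_d(ℝ) → ℒ_d`). -/
def IsLocalMaxCovrad {d : ℕ} (g : Matrix (Fin d) (Fin d) ℝ) : Prop :=
  ∃ W ∈ 𝓝 g, ∀ g' ∈ W, Matrix.det g' = 1 → covrad (latticeOf g') ≤ covrad (latticeOf g)

/-! ### Block upper triangular form -/

/-- Offset of the `i`-th diagonal block. -/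
def off {k : ℕ} (ns : Fin k → ℕ) (i : Fin k) : ℕ :=
  ∑ j ∈ Finset.univ.filter (fun j => j < i), ns j

lemma off_add_lt {k : ℕ} (ns : Fin k → ℕ) (i : Fin k) (a : Fin (ns i)) :
    off ns i + (a : ℕ) < ∑ j, ns j := by
  unfold off
  have hins : i ∉ Finset.univ.filter (fun j => j < i) := by simp
  have h2 : ∑ j ∈ insert i (Finset.univ.filter (fun j => j < i)), ns j ≤ ∑ j, ns j :=
    Finset.sum_le_sum_of_subset (Finset.subset_univ _)
  rw [Finset.sum_insert hins] at h2
  have := a.isLt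
  omega

/-- The position, in `Fin n`, of the `a`-th coordinate of the `i`-th block. -/
def blockEmb {n k : ℕ} (ns : Fin k → ℕ) (hsum : (∑ j, ns j) = n) (i : Fin k)
    (a : Fin (ns i)) : Fin n :=
  ⟨off ns i + (a : ℕ), hsum ▸ off_add_lt ns i a⟩

/-- `g` is block upper triangular with diagonal blocks `G i` (block sizes `ns`). -/
def IsBlockUT {n k : ℕ} (ns : Fin k → ℕ) (hsum : (∑ j, ns j) = n)
    (g : Matrix (Fin n) (Fin n) ℝ) (G : ∀ i, Matrix (Fin (ns i)) (Fin (ns i)) ℝ) : Prop :=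
  (∀ (i : Fin k) (a b : Fin (ns i)),
      g (blockEmb ns hsum i a) (blockEmb ns hsum i b) = G i a b) ∧
  (∀ (i j : Fin k) (a : Fin (ns i)) (b : Fin (ns j)), j < i →
      g (blockEmb ns hsum i a) (blockEmb ns hsum j b) = 0)

/-! ### Mordell constant -/

/-- The symmetric box `[-a₁,a₁] × ⋯ × [-aₙ,aₙ]` is admissible for `L`: its interior contains
no nonzero point of `L`. -/
def IsAdmissibleBox {n : ℕ} (L : AddSubgroup (Fin n → ℝ)) (a : Fin n → ℝ) : Prop :=
  (∀ i, 0 < a i) ∧ ∀ v ∈ L, v ≠ 0 → ∃ i, a i ≤ |v i|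

/-- The Mordell constant `κ(L) = 2⁻ⁿ sup { Vol(B) : B admissible symmetric box for L }`. -/
def mordellConst {n : ℕ} (L : AddSubgroup (Fin n → ℝ)) : ℝ :=
  (1 / 2 ^ n) * sSup {V | ∃ a : Fin n → ℝ, IsAdmissibleBox L a ∧ V = ∏ i, 2 * a i}

/-! ### Hermite constant -/

/-- Length of a shortest nonzero vector of `L`. -/
def shortest {m : ℕ} (L : AddSubgroup (Fin m → ℝ)) : ℝ :=
  sInf {t | ∃ w ∈ L, w ≠ 0 ∧ t = enorm w}

/-- The Hermite constant `γ_m`. -/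
def hermiteConst (m : ℕ) : ℝ :=
  sSup {c | ∃ L : AddSubgroup (Fin m → ℝ), IsUnimodularLattice L ∧ c = shortest L ^ 2}

/-! ### Korkine–Zolotarev reduction -/

/-- `v 0, …, v (n-1)` is a Korkine–Zolotarev reduced basis of `x`: it is a ℤ-basis, and for
each `i` the orthogonal projection of `v i` onto `span(v 0, …, v (i-1))^⊥` is shortest among the
nonzero such projections of vectors of `x` (projection lengths are expressed through Gram
determinants: the projection of `w` has length `gvol (v 0, …, v (i-1), w) / gvol (v 0, …, v (i-1))`). -/
def IsKZBasis {n : ℕ} (x : AddSubgroup (Fin n → ℝ)) (v : ℕ → (Fin n → ℝ)) : Prop :=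
  LinearIndependent ℝ (fun j : Fin n => v (j : ℕ)) ∧
  x = AddSubgroup.closure (v '' Set.Iio n) ∧
  ∀ i < n, ∀ w ∈ x, w ∉ Submodule.span ℝ (v '' Set.Iio i) →
    gvol (Fin.snoc (fun j : Fin i => v (j : ℕ)) (v i)) ≤
      gvol (Fin.snoc (fun j : Fin i => v (j : ℕ)) w)

/-- `A 0, …, A (n-1)` are the diagonal Korkine–Zolotarev coefficients of `x`: the lengths of
the successive orthogonal projections in a KZ reduced basis, i.e.
`A i = gvol (v 0, …, v i) / gvol (v 0, …, v (i-1))`. -/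
def HasKZCoeffs {n : ℕ} (x : AddSubgroup (Fin n → ℝ)) (A : ℕ → ℝ) : Prop :=
  ∃ v : ℕ → (Fin n → ℝ), IsKZBasis x v ∧
    ∀ i < n, A i * gvol (fun j : Fin i => v (j : ℕ)) = gvol (fun j : Fin (i + 1) => v (j : ℕ))

/-! ### Orthogonal complements and projections of lattices -/

/-- The orthogonal complement of a subspace `V ⊆ ℝⁿ`. -/
def orthoC {n : ℕ} (V : Submodule ℝ (Fin n → ℝ)) : Submodule ℝ (Fin n → ℝ) where
  carrier := {w | ∀ v ∈ V, einner w v = 0}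
  zero_mem' := by intro v hv; simp [einner]
  add_mem' := by intro a b ha hb v hv; rw [einner_add_left, ha v hv, hb v hv, add_zero]
  smul_mem' := by intro c w hw v hv; rw [einner_smul_left, hw v hv, mul_zero]

/-- The image `π(x)` of `x` under the orthogonal projection `π : ℝⁿ → V^⊥`:
`p = π(u)` iff `p ⊥ V` and `u - p ∈ V`. -/
def projLat {n : ℕ} (V : Submodule ℝ (Fin n → ℝ)) (x : AddSubgroup (Fin n → ℝ)) :
    AddSubgroup (Fin n → ℝ) where
  carrier := {p | (∀ v ∈ V, einner p v = 0) ∧ ∃ u ∈ x, u - p ∈ V}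
  zero_mem' := ⟨by intro v hv; simp [einner], 0, x.zero_mem, by rw [sub_zero]; exact V.zero_mem⟩
  add_mem' := by
    rintro p q ⟨hp1, u1, hu1, hp2⟩ ⟨hq1, u2, hu2, hq2⟩
    refine ⟨fun v hv => by rw [einner_add_left, hp1 v hv, hq1 v hv, add_zero],
      u1 + u2, x.add_mem hu1 hu2, ?_⟩
    have h : u1 + u2 - (p + q) = u1 - p + (u2 - q) := by abel
    rw [h]; exact V.add_mem hp2 hq2
  neg_mem' := by
    rintro p ⟨hp1, u, hu, hp2⟩
    refine ⟨fun v hv => by rw [einner_neg_left, hp1 v hv, neg_zero],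
      -u, x.neg_mem hu, ?_⟩
    have h : -u - -p = -(u - p) := by abel
    rw [h]; exact V.neg_mem hp2

end SW

namespace SW

/-! ### Gram determinants and orthogonal projections -/

section Gram

variable {n : ℕ} {ι κ : Type*} [Fintype ι] [DecidableEq ι] [Fintype κ] [DecidableEq κ]

/-- The Gram determinant of the rows of a matrix. -/
def gramDet (V : Matrix ι (Fin n) ℝ) : ℝ := (V * Vᵀ).det

/-- The orthogonal projection onto the row space of a matrix with independent rows. -/
def rowProj (V : Matrix ι (Fin n) ℝ) : Matrix (Fin n) (Fin n) ℝ := Vᵀ * (V * Vᵀ)⁻¹ * V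

lemma posSemidef_mul_transpose {μ : Type*} [Finite μ] (V : Matrix μ (Fin n) ℝ) :
    (V * Vᵀ).PosSemidef := by
  simpa using posSemidef_self_mul_conjTranspose V

lemma gramDet_nonneg (V : Matrix ι (Fin n) ℝ) : 0 ≤ gramDet V :=
  (posSemidef_mul_transpose V).det_nonneg

lemma gramDet_pos {V : Matrix ι (Fin n) ℝ} (hV : gramDet V ≠ 0) : 0 < gramDet V :=
  lt_of_le_of_ne (gramDet_nonneg V) (Ne.symm hV)

lemma gramDet_of_isEmpty [IsEmpty ι] (V : Matrix ι (Fin n) ℝ) : gramDet V = 1 := by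
  simp [gramDet]

lemma gramDet_mul (C : Matrix ι ι ℝ) (V : Matrix ι (Fin n) ℝ) :
    gramDet (C * V) = C.det ^ 2 * gramDet V := by
  have : C * V * (C * V)ᵀ = C * (V * Vᵀ) * Cᵀ := by
    simp only [transpose_mul, Matrix.mul_assoc]
  rw [gramDet, this, det_mul, det_mul, det_transpose, gramDet]
  ring

lemma gramDet_square (V : Matrix (Fin n) (Fin n) ℝ) : gramDet V = V.det ^ 2 := by
  rw [gramDet, det_mul, det_transpose, sq]

lemma gramDet_submatrix_equiv (V : Matrix κ (Fin n) ℝ) (e : ι ≃ κ) :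
    gramDet (V.submatrix e id) = gramDet V := by
  have : V.submatrix e id * (V.submatrix e id)ᵀ = (V * Vᵀ).submatrix e e := by
    ext i j; simp [mul_apply]
  rw [gramDet, this, det_submatrix_equiv_self, gramDet]

lemma rowProj_transpose (V : Matrix ι (Fin n) ℝ) : (rowProj V)ᵀ = rowProj V := by
  simp only [rowProj, transpose_mul, transpose_transpose, transpose_nonsing_inv, Matrix.mul_assoc]

lemma mul_rowProj {V : Matrix ι (Fin n) ℝ} (hV : gramDet V ≠ 0) : V * rowProj V = V := by
  have h : IsUnit (V * Vᵀ).det := isUnit_iff_ne_zero.mpr hV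
  rw [rowProj, ← Matrix.mul_assoc, ← Matrix.mul_assoc, mul_nonsing_inv _ h, Matrix.one_mul]

lemma rowProj_mul_rowProj {V : Matrix ι (Fin n) ℝ} {W : Matrix κ (Fin n) ℝ}
    (hW : gramDet W ≠ 0) {C : Matrix ι κ ℝ} (hC : V = C * W) :
    rowProj V * rowProj W = rowProj V := by
  rw [rowProj, Matrix.mul_assoc]
  congr 1
  rw [hC, Matrix.mul_assoc, mul_rowProj hW]

lemma rowProj_mul_rowProj' {V : Matrix ι (Fin n) ℝ} {W : Matrix κ (Fin n) ℝ}
    (hW : gramDet W ≠ 0) {C : Matrix ι κ ℝ} (hC : V = C * W) :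
    rowProj W * rowProj V = rowProj V := by
  have := congrArg transpose (rowProj_mul_rowProj hW hC)
  rwa [transpose_mul, rowProj_transpose, rowProj_transpose] at this

lemma rowProj_idem {V : Matrix ι (Fin n) ℝ} (hV : gramDet V ≠ 0) :
    rowProj V * rowProj V = rowProj V :=
  rowProj_mul_rowProj hV (Matrix.one_mul V).symm

lemma trace_rowProj {V : Matrix ι (Fin n) ℝ} (hV : gramDet V ≠ 0) :
    (rowProj V).trace = Fintype.card ι := by
  have h : IsUnit (V * Vᵀ).det := isUnit_iff_ne_zero.mpr hV
  rw [rowProj, trace_mul_comm, ← Matrix.mul_assoc, mul_nonsing_inv _ h, trace_one]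

lemma rowProj_mul {V : Matrix ι (Fin n) ℝ} {C : Matrix ι ι ℝ} (hC : C.det ≠ 0) :
    rowProj (C * V) = rowProj V := by
  have h : IsUnit C.det := isUnit_iff_ne_zero.mpr hC
  have h' : IsUnit Cᵀ.det := by rwa [det_transpose]
  have : C * V * (C * V)ᵀ = C * (V * Vᵀ) * Cᵀ := by
    simp only [transpose_mul, Matrix.mul_assoc]
  rw [rowProj, this, Matrix.mul_inv_rev, Matrix.mul_inv_rev, transpose_mul]
  calc Vᵀ * Cᵀ * (Cᵀ⁻¹ * ((V * Vᵀ)⁻¹ * C⁻¹)) * (C * V)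
      = Vᵀ * (Cᵀ * Cᵀ⁻¹) * (V * Vᵀ)⁻¹ * (C⁻¹ * C) * V := by simp only [Matrix.mul_assoc]
    _ = _ := by
      rw [mul_nonsing_inv _ h', nonsing_inv_mul _ h, Matrix.mul_one, Matrix.mul_one, rowProj]

/-- A symmetric idempotent matrix is positive semidefinite. -/
lemma posSemidef_of_symm_idem {P : Matrix (Fin n) (Fin n) ℝ} (hs : Pᵀ = P) (hi : P * P = P) :
    P.PosSemidef := by
  have := posSemidef_mul_transpose P
  rwa [hs, hi] at this

lemma posSemidef_mul_mul_transpose {μ : Type*} [Finite μ] {P : Matrix (Fin n) (Fin n) ℝ}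
    (hP : P.PosSemidef) (W : Matrix μ (Fin n) ℝ) : (W * P * Wᵀ).PosSemidef := by
  simpa using hP.mul_mul_conjTranspose_same W

/-- The spectral theorem for real symmetric matrices. -/
lemma exists_orthogonal_diagonal {S : Matrix ι ι ℝ} (hS : S.IsHermitian) :
    ∃ (U : Matrix ι ι ℝ) (l : ι → ℝ), U * Uᵀ = 1 ∧ Uᵀ * U = 1 ∧ S = U * diagonal l * Uᵀ ∧
      (S.PosSemidef → ∀ i, 0 ≤ l i) := by
  have hsp := hS.spectral_theorem
  rw [Unitary.conjStarAlgAut_apply] at hsp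
  refine ⟨(hS.eigenvectorUnitary : Matrix ι ι ℝ), hS.eigenvalues, ?_, ?_, ?_, ?_⟩
  · simpa [star_eq_conjTranspose] using Unitary.coe_mul_star_self hS.eigenvectorUnitary
  · simpa [star_eq_conjTranspose] using Unitary.coe_star_mul_self hS.eigenvectorUnitary
  · simpa [star_eq_conjTranspose, Function.comp_def] using hsp
  · exact fun h i => h.eigenvalues_nonneg i

lemma exists_transpose_mul_self {S : Matrix ι ι ℝ} (hS : S.PosSemidef) :
    ∃ C : Matrix ι ι ℝ, S = Cᵀ * C := by
  obtain ⟨U, l, -, -, h, hl⟩ := exists_orthogonal_diagonal hS.1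
  refine ⟨diagonal (fun i => √(l i)) * Uᵀ, ?_⟩
  rw [transpose_mul, diagonal_transpose, transpose_transpose, Matrix.mul_assoc,
    ← Matrix.mul_assoc (diagonal _), diagonal_mul_diagonal, ← Matrix.mul_assoc]
  simp_rw [Real.mul_self_sqrt (hl hS _)]
  exact h

/-- The determinant is monotone on positive semidefinite matrices. -/
lemma det_le_det_add {A B : Matrix ι ι ℝ} (hA : A.PosSemidef) (hB : B.PosSemidef) :
    A.det ≤ (A + B).det := by
  by_cases h0 : A.det = 0
  · rw [h0]; exact (hA.add hB).det_nonneg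
  obtain ⟨C, hC⟩ := exists_transpose_mul_self hA
  have hCd : IsUnit C.det := by
    rw [isUnit_iff_ne_zero]; rintro h; apply h0; rw [hC, det_mul, h, mul_zero]
  have hCd' : IsUnit Cᵀ.det := by rwa [det_transpose]
  set D := (C⁻¹)ᵀ * B * C⁻¹ with hD
  have hDp : D.PosSemidef := by
    simpa using hB.conjTranspose_mul_mul_same C⁻¹
  have hAB : A + B = Cᵀ * (1 + D) * C := by
    rw [Matrix.mul_add, Matrix.add_mul, Matrix.mul_one, ← hC, hD]
    congr 1
    calc B = (Cᵀ * Cᵀ⁻¹) * B * (C⁻¹ * C) := by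
          rw [mul_nonsing_inv _ hCd', nonsing_inv_mul _ hCd, Matrix.one_mul, Matrix.mul_one]
      _ = _ := by simp only [transpose_nonsing_inv, Matrix.mul_assoc]
  have h1 : 1 ≤ (1 + D).det := by
    obtain ⟨U, l, hUU, -, hl, hl0⟩ := exists_orthogonal_diagonal hDp.1
    have hUd : U.det * Uᵀ.det = 1 := by rw [← det_mul, hUU, det_one]
    have : 1 + D = U * diagonal (fun i => 1 + l i) * Uᵀ := by
      have e : diagonal (fun i => 1 + l i) = 1 + diagonal l := by
        rw [← diagonal_one, diagonal_add]
      rw [e, Matrix.mul_add, Matrix.add_mul, Matrix.mul_one, hUU, hl]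
    rw [this, det_mul, det_mul, det_diagonal, mul_right_comm, hUd, one_mul]
    exact Finset.one_le_prod fun i _ => by linarith [hl0 hDp i]
  rw [hAB, hC, det_mul, det_mul, det_mul, det_transpose]
  nlinarith [mul_self_nonneg C.det]

lemma gramDet_fromRows {V : Matrix ι (Fin n) ℝ} (hV : gramDet V ≠ 0) (W : Matrix κ (Fin n) ℝ) :
    gramDet (fromRows V W) = gramDet V * (W * (1 - rowProj V) * Wᵀ).det := by
  have h : IsUnit (V * Vᵀ).det := isUnit_iff_ne_zero.mpr hV
  have : Invertible (V * Vᵀ) := invertibleOfIsUnitDet _ h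
  rw [gramDet, transpose_fromRows, fromRows_mul_fromCols, det_fromBlocks₁₁, gramDet]
  congr 2
  rw [invOf_eq_nonsing_inv, Matrix.mul_sub, Matrix.sub_mul, Matrix.mul_one, rowProj]
  simp only [Matrix.mul_assoc]

end Gram

/-! ### Gram determinants: submodularity and convexity along the diagonal group -/

section Convex

variable {n : ℕ} {ι κ μ : Type*} [Fintype ι] [DecidableEq ι] [Fintype κ] [DecidableEq κ]
  [Fintype μ] [DecidableEq μ]

/-- Submodularity of the covolume. -/
lemma gramDet_submodular {V : Matrix ι (Fin n) ℝ} {A : Matrix κ (Fin n) ℝ}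
    (hV : gramDet V ≠ 0) (hA : gramDet (fromRows V A) ≠ 0) (B : Matrix μ (Fin n) ℝ) :
    gramDet (fromRows (fromRows V A) B) * gramDet V
      ≤ gramDet (fromRows V A) * gramDet (fromRows V B) := by
  rw [gramDet_fromRows hA, gramDet_fromRows hV B]
  have hC : V = fromCols (1 : Matrix ι ι ℝ) (0 : Matrix ι κ ℝ) * fromRows V A := by
    simp [fromCols_mul_fromRows]
  have e1 := rowProj_mul_rowProj hA hC
  have e2 := rowProj_mul_rowProj' hA hC
  set P := rowProj V with hP
  set Q := rowProj (fromRows V A) with hQ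
  have hPS : (Q - P).PosSemidef := by
    refine posSemidef_of_symm_idem ?_ ?_
    · rw [transpose_sub, hP, hQ, rowProj_transpose, rowProj_transpose]
    · rw [Matrix.sub_mul, Matrix.mul_sub, Matrix.mul_sub, e1, e2, hP, hQ, rowProj_idem hV,
        rowProj_idem hA]
      abel
  have h1 : (1 - Q).PosSemidef := by
    refine posSemidef_of_symm_idem ?_ ?_
    · rw [transpose_sub, transpose_one, hQ, rowProj_transpose]
    · rw [Matrix.sub_mul, Matrix.mul_sub, Matrix.mul_sub, hQ, rowProj_idem hA]
      simp
  have h2 := det_le_det_add (posSemidef_mul_mul_transpose h1 B)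
    (posSemidef_mul_mul_transpose hPS B)
  have h3 : B * (1 - Q) * Bᵀ + B * (Q - P) * Bᵀ = B * (1 - P) * Bᵀ := by
    rw [← Matrix.add_mul, ← Matrix.mul_add, sub_add_sub_cancel]
  rw [h3] at h2
  nlinarith [mul_nonneg (gramDet_nonneg (fromRows V A)) (gramDet_nonneg V)]

lemma exists_orthonormal_rows {V : Matrix ι (Fin n) ℝ} (hV : gramDet V ≠ 0) (x : Fin n → ℝ) :
    ∃ (U : Matrix ι (Fin n) ℝ) (l : ι → ℝ), U * Uᵀ = 1 ∧ Uᵀ * U = rowProj V ∧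
      (∀ a, l a = ∑ i, U a i ^ 2 * x i ^ 2) ∧
      gramDet (V * diagonal x) = gramDet V * ∏ a, l a := by
  obtain ⟨C, hC⟩ := exists_transpose_mul_self (posSemidef_mul_transpose V)
  have hCd : IsUnit Cᵀ.det := by
    rw [isUnit_iff_ne_zero]; intro h
    apply hV; rw [gramDet, hC, det_mul, h, zero_mul]
  have hCd' : IsUnit C.det := by rwa [det_transpose] at hCd
  set W := (Cᵀ)⁻¹ * V with hW
  have hVW : V = Cᵀ * W := by
    rw [hW, ← Matrix.mul_assoc, mul_nonsing_inv _ hCd, Matrix.one_mul]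
  have hWW : W * Wᵀ = 1 := by
    have : W * Wᵀ = (Cᵀ)⁻¹ * (V * Vᵀ) * C⁻¹ := by
      rw [hW, transpose_mul, transpose_nonsing_inv, transpose_transpose]
      simp only [Matrix.mul_assoc]
    rw [this, hC, ← Matrix.mul_assoc, nonsing_inv_mul _ hCd, Matrix.one_mul,
      mul_nonsing_inv _ hCd']
  have hS : (W * diagonal x * (W * diagonal x)ᵀ).IsHermitian :=
    (posSemidef_mul_transpose _).1
  obtain ⟨O, l, hO1, hO2, hO3, -⟩ := exists_orthogonal_diagonal hS
  have hdiag : Oᵀ * W * diagonal x * (Oᵀ * W * diagonal x)ᵀ = diagonal l := by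
    calc Oᵀ * W * diagonal x * (Oᵀ * W * diagonal x)ᵀ
        = Oᵀ * (W * diagonal x * (W * diagonal x)ᵀ) * O := by
          simp only [transpose_mul, transpose_transpose, Matrix.mul_assoc]
      _ = (Oᵀ * O) * diagonal l * (Oᵀ * O) := by rw [hO3]; simp only [Matrix.mul_assoc]
      _ = _ := by rw [hO2, Matrix.one_mul, Matrix.mul_one]
  refine ⟨Oᵀ * W, l, ?_, ?_, ?_, ?_⟩
  · calc Oᵀ * W * (Oᵀ * W)ᵀ = Oᵀ * (W * Wᵀ) * O := by
          simp only [transpose_mul, transpose_transpose, Matrix.mul_assoc]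
      _ = 1 := by rw [hWW, Matrix.mul_one, hO2]
  · calc (Oᵀ * W)ᵀ * (Oᵀ * W) = Wᵀ * (O * Oᵀ) * W := by
          simp only [transpose_mul, transpose_transpose, Matrix.mul_assoc]
      _ = rowProj W := by rw [hO1, Matrix.mul_one, rowProj, hWW, inv_one, Matrix.mul_one]
      _ = rowProj V := by rw [hVW, rowProj_mul hCd.ne_zero]
  · intro a
    have := congrFun (congrFun hdiag a) a
    rw [diagonal_apply_eq] at this
    rw [← this, mul_apply]
    refine Finset.sum_congr rfl fun i _ => ?_
    rw [transpose_apply, mul_diagonal]; ring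
  · have h1 : gramDet V = Cᵀ.det ^ 2 := by
      rw [gramDet, hC, det_mul, det_transpose]; ring
    rw [h1, hVW, Matrix.mul_assoc, gramDet_mul]
    congr 1
    rw [gramDet, hO3, det_mul, det_mul, det_diagonal, mul_right_comm, ← det_mul, hO1, det_one,
      one_mul]

lemma exp_sum_rowProj_le {V : Matrix ι (Fin n) ℝ} (hV : gramDet V ≠ 0) (t : Fin n → ℝ) :
    gramDet V * Real.exp (2 * ∑ i, t i * rowProj V i i)
        ≤ gramDet (V * diagonal fun i => Real.exp (t i)) ∧
      ((∃ i k, t i * rowProj V i k ≠ rowProj V i k * t k) →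
        gramDet V * Real.exp (2 * ∑ i, t i * rowProj V i i)
          < gramDet (V * diagonal fun i => Real.exp (t i))) := by
  obtain ⟨U, l, hU1, hU2, hl, hdet⟩ := exists_orthonormal_rows hV fun i => Real.exp (t i)
  have hw : ∀ a, ∑ i, U a i ^ 2 = 1 := by
    intro a
    have := congrFun (congrFun hU1 a) a
    rw [mul_apply, one_apply_eq] at this
    rw [← this]
    exact Finset.sum_congr rfl fun i _ => by rw [transpose_apply]; ring
  have hl' : ∀ a, l a = ∑ i, U a i ^ 2 • Real.exp (2 * t i) := by
    intro a
    rw [hl]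
    refine Finset.sum_congr rfl fun i _ => ?_
    rw [smul_eq_mul, ← Real.exp_nat_mul]; norm_num
  have hJ : ∀ a, Real.exp (∑ i, U a i ^ 2 • (2 * t i)) ≤ l a := by
    intro a
    rw [hl']
    exact convexOn_exp.map_sum_le (fun i _ => sq_nonneg _) (hw a) (fun i _ => Set.mem_univ _)
  have hexp : Real.exp (2 * ∑ i, t i * rowProj V i i)
      = ∏ a, Real.exp (∑ i, U a i ^ 2 • (2 * t i)) := by
    rw [← Real.exp_sum, Finset.sum_comm, Finset.mul_sum, ← hU2]
    congr 1
    refine Finset.sum_congr rfl fun i _ => ?_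
    rw [mul_apply, Finset.mul_sum, Finset.mul_sum]
    refine Finset.sum_congr rfl fun a _ => ?_
    rw [transpose_apply, smul_eq_mul]; ring
  rw [hdet, hexp]
  refine ⟨mul_le_mul_of_nonneg_left
    (Finset.prod_le_prod (fun _ _ => (Real.exp_pos _).le) fun a _ => hJ a) (gramDet_nonneg V), ?_⟩
  rintro ⟨i, k, hik⟩
  refine mul_lt_mul_of_pos_left ?_ (gramDet_pos hV)
  refine Finset.prod_lt_prod (fun _ _ => Real.exp_pos _) (fun a _ => hJ a) ?_
  by_contra! hcon
  apply hik
  have heq : ∀ a i, U a i * t i = U a i * ∑ k, U a k ^ 2 * t k := by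
    intro a i
    have h1 := le_antisymm (hJ a) (hcon a (Finset.mem_univ _))
    rw [hl', strictConvexOn_exp.map_sum_eq_iff' (fun i _ => sq_nonneg _) (hw a)
      (fun i _ => Set.mem_univ _)] at h1
    by_cases h0 : U a i = 0
    · simp [h0]
    · have := h1 i (Finset.mem_univ _) (pow_ne_zero 2 h0)
      have h2 : t i = ∑ k, U a k ^ 2 * t k := by
        have h3 : ∑ k, U a k ^ 2 • (2 * t k) = 2 * ∑ k, U a k ^ 2 * t k := by
          rw [Finset.mul_sum]
          exact Finset.sum_congr rfl fun k _ => by rw [smul_eq_mul]; ring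
        rw [h3] at this
        linarith
      rw [← h2]
  rw [← hU2, mul_apply, Finset.mul_sum, Finset.sum_mul]
  refine Finset.sum_congr rfl fun a _ => ?_
  rw [transpose_apply]
  linear_combination U a k * heq a i - U a i * heq a k

/-- A crude lower bound for the change of the covolume under the diagonal group. -/
lemma exp_neg_mul_gramDet_le {V : Matrix ι (Fin n) ℝ} (hV : gramDet V ≠ 0) {t : Fin n → ℝ}
    {η : ℝ} (ht : ∀ i, |t i| ≤ η) :
    Real.exp (-(2 * n * η)) * gramDet V ≤ gramDet (V * diagonal fun i => Real.exp (t i)) := by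
  refine le_trans ?_ (exp_sum_rowProj_le hV t).1
  rw [mul_comm]
  refine mul_le_mul_of_nonneg_left (Real.exp_le_exp.mpr ?_) (gramDet_nonneg V)
  have hidem := rowProj_idem hV
  have hd : ∀ i, 0 ≤ rowProj V i i ∧ rowProj V i i ≤ 1 := by
    intro i
    have h1 := congrFun (congrFun hidem i) i
    rw [mul_apply] at h1
    have h2 : ∀ k, rowProj V i k * rowProj V k i = rowProj V i k ^ 2 := by
      intro k
      have := congrFun (congrFun (rowProj_transpose V) i) k
      rw [transpose_apply] at this
      rw [this]; ring
    simp_rw [h2] at h1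
    have h3 : rowProj V i i ^ 2 ≤ ∑ k, rowProj V i k ^ 2 :=
      Finset.single_le_sum (f := fun k => rowProj V i k ^ 2) (fun k _ => sq_nonneg _)
        (Finset.mem_univ i)
    have h4 : 0 ≤ ∑ k, rowProj V i k ^ 2 := Finset.sum_nonneg fun k _ => sq_nonneg _
    constructor <;> nlinarith
  have : ∑ i : Fin n, -η ≤ ∑ i, t i * rowProj V i i := by
    refine Finset.sum_le_sum fun i _ => ?_
    have := abs_le.mp (ht i)
    nlinarith [hd i]
  rw [Finset.sum_const, Finset.card_univ, Fintype.card_fin, nsmul_eq_mul] at this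
  linarith

end Convex

/-! ### Chains of projections and diagonal matrices -/

section Chain

variable {n : ℕ}

lemma one_le_trace_of_idem {E : Matrix (Fin n) (Fin n) ℝ} (h : E * E = E) (h0 : E ≠ 0) :
    1 ≤ E.trace := by
  have hi : IsIdempotentElem (toLin' E) := by
    rw [IsIdempotentElem, Module.End.mul_eq_comp, ← toLin'_mul, h]
  have ht := (LinearMap.IsIdempotentElem.isProj_range _ hi).trace
  rw [Matrix.trace_toLin'_eq] at ht
  rw [ht, Nat.one_le_cast, Nat.one_le_iff_ne_zero]
  intro h1
  rw [h1, Nat.cast_zero] at ht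
  apply h0
  have := (LinearMap.IsIdempotentElem.trace_eq_zero_iff hi).mp (by rw [Matrix.trace_toLin'_eq, ht])
  simpa using this

/-- A finite chain of projections, indexed by rank, extends to a chain indexed by `0, …, n`. -/
lemma exists_chain_extension {s : Finset ℕ} (hs : ∀ j ∈ s, 0 < j ∧ j < n)
    {P : ℕ → Matrix (Fin n) (Fin n) ℝ}
    (hP : ∀ i ∈ s, ∀ j ∈ s, i ≤ j → P i * P j = P i ∧ P j * P i = P i) :
    ∃ Q : ℕ → Matrix (Fin n) (Fin n) ℝ, Q 0 = 0 ∧ Q n = 1 ∧ (∀ j ∈ s, Q j = P j) ∧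
      (∀ i j, i ≤ j → Q i * Q j = Q i ∧ Q j * Q i = Q i) ∧
      (∀ j, Q j = 0 ∨ Q j = 1 ∨ ∃ i ∈ s, Q j = P i) := by
  set P' : ℕ → Matrix (Fin n) (Fin n) ℝ :=
    fun j => if j = 0 then 0 else if j = n then 1 else P j with hP'
  set S : ℕ → Prop := fun j => j = 0 ∨ j = n ∨ j ∈ s with hS
  classical
  have hchain : ∀ i j, S i → S j → i ≤ j → P' i * P' j = P' i ∧ P' j * P' i = P' i := by
    intro i j hi hj hij
    simp only [hP']
    by_cases hi0 : i = 0
    · simp [hi0]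
    by_cases hj0 : j = 0
    · omega
    by_cases hjn : j = n
    · have hn0 : n ≠ 0 := by omega
      simp [hjn, hn0, hi0]
    by_cases hin : i = n
    · rcases hj with hj | hj | hj
      · omega
      · omega
      · have := hs j hj; omega
    · simp only [if_neg hi0, if_neg hj0, if_neg hin, if_neg hjn]
      exact hP i (by simpa [hS, hi0, hin] using hi) j (by simpa [hS, hj0, hjn] using hj) hij
  have hm : ∀ j, S (Nat.findGreatest S j) := fun j => Nat.findGreatest_spec (Nat.zero_le j) (Or.inl rfl)
  refine ⟨fun j => P' (Nat.findGreatest S j), ?_, ?_, ?_, ?_, ?_⟩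
  · simp [hP']
  · simp only
    rw [Nat.findGreatest_eq (by simp [hS])]
    simp only [hP']
    split_ifs with h
    · subst h; exact Subsingleton.elim _ _
    · rfl
  · intro j hj
    have := hs j hj
    simp only
    rw [Nat.findGreatest_eq (by simp [hS, hj])]
    simp only [hP']
    rw [if_neg (by omega), if_neg (by omega)]
  · intro i j hij
    exact hchain _ _ (hm i) (hm j) (Nat.findGreatest_mono_right S hij)
  · intro j
    simp only [hP']
    rcases hm j with h | h | h
    · left; rw [if_pos h]
    · by_cases h0 : Nat.findGreatest S j = 0
      · left; rw [if_pos h0]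
      · right; left; rw [if_neg h0, if_pos h]
    · have := hs _ h
      right; right
      exact ⟨_, h, by rw [if_neg (by omega), if_neg (by omega)]⟩

/-- If the trace-zero diagonal directions along which no projection of a chain changes its
diagonal mass all commute with the chain, then some diagonal direction increases the mass of every
projection of the chain. -/
lemma exists_increasing_direction {s : Finset ℕ} (hs : ∀ j ∈ s, 0 < j ∧ j < n)
    {P : ℕ → Matrix (Fin n) (Fin n) ℝ}
    (hP : ∀ i ∈ s, ∀ j ∈ s, i ≤ j → P i * P j = P i ∧ P j * P i = P i)
    (htr : ∀ j ∈ s, (P j).trace = j)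
    (hcomm : ∀ t : Fin n → ℝ, ∑ i, t i = 0 → (∀ j ∈ s, ∑ i, t i * P j i i = 0) →
      ∀ j ∈ s, ∀ i k, t i * P j i k = P j i k * t k) :
    ∃ t : Fin n → ℝ, ∑ i, t i = 0 ∧ ∀ j ∈ s, 0 < ∑ i, t i * P j i i := by
  classical
  obtain ⟨Q, hQ0, hQn, hQs, hQ, hQc⟩ := exists_chain_extension hs hP
  set T : Set (Fin n → ℝ) := {t | ∑ i, t i = 0 ∧ ∀ j ∈ s, ∑ i, t i * P j i i = 0} with hT
  let R : Setoid (Fin n) :=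
    { r := fun i k => ∀ t ∈ T, t i = t k
      iseqv := ⟨fun _ _ _ => rfl, fun h t ht => (h t ht).symm,
        fun h h' t ht => (h t ht).trans (h' t ht)⟩ }
  let c : Fin n → Quotient R := fun i => Quotient.mk R i
  let D : Quotient R → Matrix (Fin n) (Fin n) ℝ := fun b => diagonal fun i => if c i = b then 1 else 0
  have hDD : ∀ b, D b * D b = D b := by
    intro b
    simp only [D, diagonal_mul_diagonal]
    congr 1; ext i; split_ifs <;> simp
  have hDsum : ∑ b, D b = 1 := by
    ext i k
    rw [Matrix.sum_apply]
    by_cases hik : i = k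
    · subst hik; simp [D]
    · simp [D, hik]
  have hDP : ∀ j ∈ s, ∀ b, D b * P j = P j * D b := by
    intro j hj b
    ext i k
    simp only [D, diagonal_mul, mul_diagonal]
    by_cases h0 : P j i k = 0
    · simp [h0]
    · have : c i = c k := by
        refine Quotient.sound fun t ht => ?_
        have := hcomm t ht.1 ht.2 j hj i k
        rw [mul_comm] at this
        exact mul_left_cancel₀ h0 this
      rw [this, mul_comm]
  have hDQ : ∀ j b, D b * Q j = Q j * D b := by
    intro j b
    rcases hQc j with h | h | ⟨i, hi, h⟩
    · rw [h]; simp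
    · rw [h]; simp
    · rw [h, hDP i hi]
  let E : Fin n → Quotient R → Matrix (Fin n) (Fin n) ℝ := fun i b => D b * (Q (i + 1) - Q i)
  have hEE : ∀ i b, E i b * E i b = E i b := by
    intro i b
    have h1 : (Q (i + 1) - Q i) * (Q (i + 1) - Q i) = Q (i + 1) - Q i := by
      rw [Matrix.sub_mul, Matrix.mul_sub, Matrix.mul_sub, (hQ i (i + 1) (by omega)).1,
        (hQ i (i + 1) (by omega)).2, (hQ i i le_rfl).1, (hQ (i + 1) (i + 1) le_rfl).1]
      abel
    have h2 : D b * (Q (i + 1) - Q i) = (Q (i + 1) - Q i) * D b := by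
      rw [Matrix.mul_sub, Matrix.sub_mul, hDQ, hDQ]
    calc E i b * E i b = D b * ((Q (i + 1) - Q i) * D b) * (Q (i + 1) - Q i) := by
          simp only [E, Matrix.mul_assoc]
      _ = (D b * D b) * ((Q (i + 1) - Q i) * (Q (i + 1) - Q i)) := by
          rw [← h2]; simp only [Matrix.mul_assoc]
      _ = E i b := by rw [h1, hDD]
  have hEsum : ∀ j, j ≤ n → ∀ b, ∑ i : Fin n, (if (i : ℕ) < j then E i b else 0) = D b * Q j := by
    intro j hj b
    rw [Fin.sum_univ_eq_sum_range (fun i => if i < j then D b * (Q (i + 1) - Q i) else 0) n,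
      ← Finset.sum_filter]
    have : (Finset.range n).filter (· < j) = Finset.range j := by
      ext i; simp; omega
    rw [this, ← Finset.mul_sum, Finset.sum_range_sub, hQ0, sub_zero]
  let K := {p : Fin n × Quotient R // E p.1 p.2 ≠ 0}
  have hcard : Fintype.card K ≤ n := by
    have h1 : ∑ i, ∑ b, (E i b).trace = n := by
      have h2 : ∀ b, ∑ i, (E i b).trace = (D b).trace := by
        intro b
        have := hEsum n le_rfl b
        simp only [Fin.is_lt, if_true, hQn, Matrix.mul_one] at this
        rw [← this, trace_sum]
      rw [Finset.sum_comm]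
      simp_rw [h2]
      rw [← trace_sum, hDsum, trace_one, Fintype.card_fin]
    have h3 : ∑ p : K, (1 : ℝ) ≤ ∑ p : Fin n × Quotient R, (E p.1 p.2).trace := by
      calc ∑ p : K, (1 : ℝ) ≤ ∑ p : K, (E p.1.1 p.1.2).trace :=
            Finset.sum_le_sum fun p _ => one_le_trace_of_idem (hEE _ _) p.2
        _ = ∑ p ∈ Finset.univ.filter (fun p : Fin n × Quotient R => E p.1 p.2 ≠ 0),
              (E p.1 p.2).trace := by
            rw [← Finset.sum_subtype_eq_sum_filter, Finset.subtype_univ]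
        _ ≤ _ := by
            refine Finset.sum_le_sum_of_subset_of_nonneg (Finset.filter_subset _ _) ?_
            intro p _ hp
            simp only [Finset.mem_filter, Finset.mem_univ, true_and, not_not] at hp
            rw [hp]; simp
    rw [Fintype.sum_prod_type, h1] at h3
    simpa using h3
  let Φ : (Fin n → ℝ) →ₗ[ℝ] (K → ℝ) :=
    { toFun := fun t p => ∑ i, t i * E p.1.1 p.1.2 i i
      map_add' := by intro t u; ext p; simp [add_mul, Finset.sum_add_distrib]
      map_smul' := by intro a t; ext p; simp [mul_assoc, Finset.mul_sum] }
  have hall : ∀ t (f : Fin n → Quotient R → ℝ), (∀ i b, E i b = 0 → f i b = 0) →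
      Φ t = (fun p => f p.1.1 p.1.2) → ∀ i b, ∑ k, t k * E i b k k = f i b := by
    intro t f hf h i b
    by_cases h0 : E i b = 0
    · rw [h0, hf i b h0]; simp
    · exact congrFun h ⟨(i, b), h0⟩
  have hpart : ∀ (t : Fin n → ℝ) (f : Fin n → Quotient R → ℝ),
      (∀ i b, ∑ k, t k * E i b k k = f i b) → ∀ j, j ≤ n → ∀ b,
      ∑ k, t k * (D b * Q j) k k = ∑ i : Fin n, if (i : ℕ) < j then f i b else 0 := by
    intro t f h j hj b
    rw [← hEsum j hj b]
    simp only [Matrix.sum_apply, Finset.mul_sum]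
    rw [Finset.sum_comm]
    refine Finset.sum_congr rfl fun i _ => ?_
    split_ifs
    · exact h i b
    · simp
  have hinj : Function.Injective Φ := by
    rw [injective_iff_map_eq_zero]
    intro t ht
    have h1 := hpart t (fun _ _ => 0) (hall t (fun _ _ => 0) (fun _ _ _ => rfl) ht)
    simp only [ite_self, Finset.sum_const_zero] at h1
    have hTb : ∀ b, (fun k => if c k = b then t k else 0) ∈ T := by
      intro b
      constructor
      · have := h1 n le_rfl b
        rw [hQn, Matrix.mul_one] at this
        refine Eq.trans ?_ this
        refine Finset.sum_congr rfl fun k _ => ?_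
        simp [D]
      · intro j hj
        have := h1 j (hs j hj).2.le b
        rw [hQs j hj] at this
        refine Eq.trans ?_ this
        refine Finset.sum_congr rfl fun k _ => ?_
        simp [D]
    ext i
    have h2 : ∀ k, c k = c i → t k = t i := by
      intro k hk
      have := Quotient.exact hk _ (hTb (c i))
      simpa [hk] using this
    have h3 := (hTb (c i)).1
    have h4 : ∑ k, (if c k = c i then t k else 0) = ∑ k, (if c k = c i then t i else 0) := by
      refine Finset.sum_congr rfl fun k _ => ?_
      split_ifs with h
      · exact h2 k h
      · rfl
    rw [h4, ← Finset.sum_filter, Finset.sum_const, nsmul_eq_mul, mul_eq_zero] at h3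
    rcases h3 with h3 | h3
    · exfalso
      rw [Nat.cast_eq_zero, Finset.card_eq_zero] at h3
      have : i ∈ Finset.univ.filter (fun k => c k = c i) := by simp
      rw [h3] at this
      simp at this
    · exact h3
  have hsurj : Function.Surjective Φ := by
    have h1 := LinearMap.finrank_le_finrank_of_injective hinj
    rw [Module.finrank_fintype_fun_eq_card, Module.finrank_fintype_fun_eq_card,
      Fintype.card_fin] at h1
    refine (LinearMap.injective_iff_surjective_of_finrank_eq_finrank ?_).mp hinj
    rw [Module.finrank_fintype_fun_eq_card, Module.finrank_fintype_fun_eq_card, Fintype.card_fin]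
    omega
  set S : Matrix (Fin n) (Fin n) ℝ := ∑ l ∈ s, (P l - ((l : ℝ) / n) • (1 : Matrix _ _ ℝ)) with hSdef
  obtain ⟨t, ht⟩ := hsurj fun p => (E p.1.1 p.1.2 * S).trace
  have h1 := hpart t (fun i b => (E i b * S).trace)
    (hall t (fun i b => (E i b * S).trace) (fun i b h => by simp [h]) ht)
  have h2 : ∀ j, j ≤ n → ∑ k, t k * Q j k k = (Q j * S).trace := by
    intro j hj
    have h3 : ∀ b, (∑ i : Fin n, if (i : ℕ) < j then (E i b * S).trace else 0)
        = (D b * Q j * S).trace := by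
      intro b
      rw [← hEsum j hj b, Matrix.sum_mul, trace_sum]
      refine Finset.sum_congr rfl fun i _ => ?_
      split_ifs <;> simp
    have h4 : ∀ M : Matrix (Fin n) (Fin n) ℝ, M = ∑ b, D b * M := by
      intro M; rw [← Finset.sum_mul, hDsum, Matrix.one_mul]
    have h5 : ∑ k, t k * Q j k k = ∑ b, ∑ k, t k * (D b * Q j) k k := by
      rw [Finset.sum_comm]
      refine Finset.sum_congr rfl fun k _ => ?_
      rw [← Finset.mul_sum, ← Matrix.sum_apply, ← h4]
    rw [h5]
    simp_rw [h1 j hj, h3]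
    rw [← trace_sum, ← Finset.sum_mul, ← h4]
  refine ⟨t, ?_, ?_⟩
  · have := h2 n le_rfl
    rw [hQn, Matrix.one_mul] at this
    simp only [one_apply_eq, mul_one] at this
    rw [this, hSdef, trace_sum]
    refine Finset.sum_eq_zero fun l hl => ?_
    have hn : (n : ℝ) ≠ 0 := by
      have := hs l hl
      rw [Nat.cast_ne_zero]; omega
    rw [trace_sub, htr l hl, trace_smul, trace_one, Fintype.card_fin, smul_eq_mul,
      div_mul_cancel₀ _ hn, sub_self]
  · intro j hj
    have := h2 j (hs j hj).2.le
    rw [hQs j hj] at this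
    rw [this, hSdef, Finset.mul_sum, trace_sum]
    refine Finset.sum_pos (fun l hl => ?_) ⟨j, hj⟩
    have hn : (0 : ℝ) < n := by
      have := hs l hl
      rw [Nat.cast_pos]; omega
    have hjn : (j : ℝ) < n := by exact_mod_cast (hs j hj).2
    have hln : (l : ℝ) < n := by exact_mod_cast (hs l hl).2
    have hj0 : (0 : ℝ) < j := by exact_mod_cast (hs j hj).1
    have hl0 : (0 : ℝ) < l := by exact_mod_cast (hs l hl).1
    rw [Matrix.mul_sub, trace_sub, Matrix.mul_smul, Matrix.mul_one, trace_smul, htr j hj,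
      smul_eq_mul, sub_pos]
    rcases le_total j l with h | h
    · rw [(hP j hj l hl h).1, htr j hj, div_mul_eq_mul_div, div_lt_iff₀ hn]
      nlinarith
    · rw [(hP l hl j hj h).2, htr l hl, div_mul_eq_mul_div, div_lt_iff₀ hn]
      nlinarith

end Chain

/-! ### Increasing the covolumes of a flag -/

section Flag

variable {n : ℕ}

lemma exists_pos_scale (t : Fin n → ℝ) {η : ℝ} (hη : 0 < η) : ∃ ε > 0, ∀ i, |ε * t i| < η := by
  have h0 : 0 ≤ ∑ i, |t i| := Finset.sum_nonneg fun i _ => abs_nonneg _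
  refine ⟨η / (1 + ∑ i, |t i|), by positivity, fun i => ?_⟩
  have h1 : |t i| ≤ ∑ i, |t i| :=
    Finset.single_le_sum (f := fun i => |t i|) (fun i _ => abs_nonneg _) (Finset.mem_univ i)
  rw [abs_mul, abs_of_pos (by positivity), div_mul_eq_mul_div, div_lt_iff₀ (by positivity)]
  nlinarith

lemma mul_diagonal_exp_add {ι : Type*} [Fintype ι] (V : Matrix ι (Fin n) ℝ) (t u : Fin n → ℝ) :
    V * diagonal (fun i => Real.exp ((t + u) i))
      = V * diagonal (fun i => Real.exp (t i)) * diagonal (fun i => Real.exp (u i)) := by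
  rw [Matrix.mul_assoc, diagonal_mul_diagonal]
  simp [Real.exp_add]

/-- The covolumes of the members of a flag can be simultaneously increased by an arbitrarily small
element of the diagonal group. -/
lemma exists_flag_increase (s : Finset ℕ) (hs : ∀ j ∈ s, 0 < j ∧ j < n)
    (V : ∀ j, Matrix (Fin j) (Fin n) ℝ) (hV : ∀ j ∈ s, gramDet (V j) ≠ 0)
    (hnest : ∀ i ∈ s, ∀ j ∈ s, i ≤ j → ∃ C : Matrix (Fin i) (Fin j) ℝ, V i = C * V j)
    {η : ℝ} (hη : 0 < η) :
    ∃ t : Fin n → ℝ, ∑ i, t i = 0 ∧ (∀ i, |t i| < η) ∧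
      ∀ j ∈ s, gramDet (V j) < gramDet (V j * diagonal fun i => Real.exp (t i)) := by
  induction hc : s.card using Nat.strong_induction_on generalizing s V η with
  | _ c ih =>
  by_cases hcomm : ∀ t : Fin n → ℝ, ∑ i, t i = 0 →
      (∀ j ∈ s, ∑ i, t i * rowProj (V j) i i = 0) →
      ∀ j ∈ s, ∀ i k, t i * rowProj (V j) i k = rowProj (V j) i k * t k
  · obtain ⟨t, ht0, ht⟩ := exists_increasing_direction hs (P := fun j => rowProj (V j))
      (fun i hi j hj hij => by
        obtain ⟨C, hC⟩ := hnest i hi j hj hij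
        exact ⟨rowProj_mul_rowProj (hV j hj) hC, rowProj_mul_rowProj' (hV j hj) hC⟩)
      (fun j hj => by rw [trace_rowProj (hV j hj), Fintype.card_fin]) hcomm
    obtain ⟨ε, hε, hεt⟩ := exists_pos_scale t hη
    refine ⟨fun i => ε * t i, by rw [← Finset.mul_sum, ht0, mul_zero], hεt, fun j hj => ?_⟩
    refine lt_of_lt_of_le ?_ (exp_sum_rowProj_le (hV j hj) _).1
    have h1 : 0 < 2 * ∑ i, ε * t i * rowProj (V j) i i := by
      simp_rw [mul_assoc]
      rw [← Finset.mul_sum]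
      have := ht j hj
      positivity
    have h2 := gramDet_pos (hV j hj)
    have h3 := Real.one_lt_exp_iff.mpr h1
    nlinarith
  · push Not at hcomm
    obtain ⟨t, ht0, ht, j₀, hj₀, i₀, k₀, hne⟩ := hcomm
    obtain ⟨ε, hε, hεt⟩ := exists_pos_scale t (half_pos hη)
    set u : Fin n → ℝ := fun i => ε * t i with hu
    have hu0 : ∑ i, u i = 0 := by rw [hu, ← Finset.mul_sum, ht0, mul_zero]
    have hur : ∀ j ∈ s, 2 * ∑ i, u i * rowProj (V j) i i = 0 := by
      intro j hj
      simp_rw [hu, mul_assoc]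
      rw [← Finset.mul_sum, ht j hj]; simp
    set V' : ∀ j, Matrix (Fin j) (Fin n) ℝ := fun j => V j * diagonal fun i => Real.exp (u i)
      with hV'
    have hle : ∀ j ∈ s, gramDet (V j) ≤ gramDet (V' j) := by
      intro j hj
      have := (exp_sum_rowProj_le (hV j hj) u).1
      rwa [hur j hj, Real.exp_zero, mul_one] at this
    have hlt : gramDet (V j₀) < gramDet (V' j₀) := by
      have := (exp_sum_rowProj_le (hV j₀ hj₀) u).2 ⟨i₀, k₀, by
        intro h
        apply hne
        simp only [hu] at h
        refine mul_left_cancel₀ hε.ne' ?_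
        linear_combination h⟩
      rwa [hur j₀ hj₀, Real.exp_zero, mul_one] at this
    set s' := s.filter fun j => ¬ gramDet (V j) < gramDet (V' j) with hs'
    have hs's : ∀ j ∈ s', j ∈ s := fun j hj => (Finset.mem_filter.mp hj).1
    have hcard : s'.card < c := by
      rw [← hc]
      refine Finset.card_lt_card ⟨Finset.filter_subset _ _, fun h => ?_⟩
      exact (Finset.mem_filter.mp (h hj₀)).2 hlt
    obtain ⟨η', hη'0, hη'1, hη'2⟩ : ∃ η' : ℝ, 0 < η' ∧ η' < η / 2 ∧ ∀ j ∈ s,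
        gramDet (V j) < gramDet (V' j) →
          gramDet (V j) < Real.exp (-(2 * n * η')) * gramDet (V' j) := by
      have h1 : ∀ᶠ x : ℝ in 𝓝[>] 0, ∀ j ∈ s, gramDet (V j) < gramDet (V' j) →
          gramDet (V j) < Real.exp (-(2 * n * x)) * gramDet (V' j) := by
        rw [Filter.eventually_all_finset]
        intro j hj
        by_cases h : gramDet (V j) < gramDet (V' j)
        · have hcont : Continuous fun x : ℝ => Real.exp (-(2 * n * x)) * gramDet (V' j) := by
            fun_prop
          have h2 := hcont.tendsto 0
          simp only [mul_zero, neg_zero, Real.exp_zero, one_mul] at h2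
          exact ((h2.eventually_const_lt h).filter_mono nhdsWithin_le_nhds).mono fun x hx _ => hx
        · exact Filter.Eventually.of_forall fun x h' => absurd h' h
      have h2 : ∀ᶠ x : ℝ in 𝓝[>] 0, x ∈ Set.Ioo 0 (η / 2) :=
        Ioo_mem_nhdsGT (half_pos hη)
      obtain ⟨x, hx1, hx2⟩ := (h1.and h2).exists
      exact ⟨x, hx2.1, hx2.2, hx1⟩
    have hV'0 : ∀ j ∈ s, gramDet (V' j) ≠ 0 := fun j hj =>
      ((gramDet_pos (hV j hj)).trans_le (hle j hj)).ne'
    obtain ⟨t', ht'0, ht'1, ht'2⟩ := ih s'.card hcard s' (fun j hj => hs j (hs's j hj)) V'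
      (fun j hj => hV'0 j (hs's j hj))
      (fun i hi j hj hij => by
        obtain ⟨C, hC⟩ := hnest i (hs's i hi) j (hs's j hj) hij
        exact ⟨C, by simp only [hV']; rw [hC, Matrix.mul_assoc]⟩) hη'0 rfl
    refine ⟨u + t', ?_, fun i => ?_, fun j hj => ?_⟩
    · simp [Finset.sum_add_distrib, hu0, ht'0]
    · have h1 := abs_add_le (u i) (t' i)
      have h2 := hεt i
      have h3 := ht'1 i
      simp only [Pi.add_apply]
      have h4 : |u i| < η / 2 := h2
      linarith
    · rw [mul_diagonal_exp_add]
      by_cases h : gramDet (V j) < gramDet (V' j)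
      · exact (hη'2 j hj h).trans_le (exp_neg_mul_gramDet_le (hV'0 j hj) fun i => (ht'1 i).le)
      · exact (hle j hj).trans_lt (ht'2 j (Finset.mem_filter.mpr ⟨hj, h⟩))

end Flag

/-! ### Integer tuples -/

section IntTuple

/-- An integer matrix viewed as a real matrix. -/
def toReal {ι κ : Type*} (m : Matrix ι κ ℤ) : Matrix ι κ ℝ := m.map (Int.castRingHom ℝ)

@[simp] lemma toReal_apply {ι κ : Type*} (m : Matrix ι κ ℤ) (i : ι) (k : κ) :
    toReal m i k = (m i k : ℝ) := rfl

lemma toReal_mul {ι κ μ : Type*} [Fintype κ] (m : Matrix ι κ ℤ) (m' : Matrix κ μ ℤ) :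
    toReal (m * m') = toReal m * toReal m' := Matrix.map_mul

variable {n : ℕ} {ι κ : Type*} [Fintype ι] [DecidableEq ι] [Fintype κ] [DecidableEq κ]

lemma det_toReal (m : Matrix ι ι ℤ) : (toReal m).det = (m.det : ℝ) := by
  have := (Int.castRingHom ℝ).map_det m
  rw [RingHom.mapMatrix_apply] at this
  exact this.symm

/-- The squared covolume of the sublattice of `h ℤⁿ` spanned by an integer tuple. -/
def latVol (h : Matrix (Fin n) (Fin n) ℝ) (m : Matrix ι (Fin n) ℤ) : ℝ := gramDet (toReal m * hᵀ)

lemma det_mul_transpose_eq_zero_iff {R : Type*} [CommRing R] [LinearOrder R]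
    [IsStrictOrderedRing R] (M : Matrix ι (Fin n) R) :
    (M * Mᵀ).det = 0 ↔ ¬ LinearIndependent R M.row := by
  rw [← exists_vecMul_eq_zero_iff, ← vecMul_injective_iff]
  have h : (Function.Injective fun v => v ᵥ* M) ↔ ∀ v, v ᵥ* M = 0 → v = 0 :=
    injective_iff_map_eq_zero (Matrix.vecMulLinear M)
  rw [h]
  push Not
  refine exists_congr fun v => ?_
  rw [and_comm]
  refine and_congr_left fun _ => ⟨fun hv => ?_, fun hv => ?_⟩
  · have : (v ᵥ* M) ⬝ᵥ (v ᵥ* M) = 0 := by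
      rw [← vecMul_vecMul] at hv
      calc (v ᵥ* M) ⬝ᵥ (v ᵥ* M) = ((v ᵥ* M) ᵥ* Mᵀ) ⬝ᵥ v := by
            rw [vecMul_transpose, dotProduct_comm, dotProduct_comm _ v, dotProduct_mulVec]
        _ = 0 := by rw [hv, zero_dotProduct]
    exact dotProduct_self_eq_zero.mp this
  · rw [← vecMul_vecMul, hv, zero_vecMul]

lemma gramDet_ne_zero_iff (V : Matrix ι (Fin n) ℝ) :
    gramDet V ≠ 0 ↔ LinearIndependent ℝ V.row := by
  rw [gramDet, Ne, det_mul_transpose_eq_zero_iff, not_not]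

lemma gramDet_toReal (m : Matrix ι (Fin n) ℤ) :
    gramDet (toReal m) = ((m * mᵀ).det : ℤ) := by
  rw [← det_toReal, toReal_mul]; rfl

lemma gramDet_toReal_ne_zero_iff (m : Matrix ι (Fin n) ℤ) :
    gramDet (toReal m) ≠ 0 ↔ LinearIndependent ℤ m.row := by
  rw [gramDet_toReal, Int.cast_ne_zero, Ne, det_mul_transpose_eq_zero_iff, not_not]

lemma one_le_gramDet_toReal {m : Matrix ι (Fin n) ℤ} (hm : gramDet (toReal m) ≠ 0) :
    1 ≤ gramDet (toReal m) := by
  have h := gramDet_pos hm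
  rw [gramDet_toReal] at h ⊢
  exact_mod_cast h

lemma gramDet_mul_ne_zero {V : Matrix ι (Fin n) ℝ} (hV : gramDet V ≠ 0)
    {B : Matrix (Fin n) (Fin n) ℝ} (hB : B.det ≠ 0) : gramDet (V * B) ≠ 0 := by
  rw [gramDet_ne_zero_iff, ← vecMul_injective_iff] at hV ⊢
  have hB' : Function.Injective B.vecMul := by
    rw [vecMul_injective_iff_isUnit, isUnit_iff_isUnit_det, isUnit_iff_ne_zero]; exact hB
  intro v w hvw
  simp only [← vecMul_vecMul] at hvw
  exact hV (hB' hvw)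

lemma latVol_pos {h : Matrix (Fin n) (Fin n) ℝ} (hh : h.det ≠ 0) {m : Matrix ι (Fin n) ℤ}
    (hm : gramDet (toReal m) ≠ 0) : 0 < latVol h m :=
  gramDet_pos (gramDet_mul_ne_zero hm (by rwa [det_transpose]))

lemma card_le_of_eq_mul {μ : Type*} [Fintype μ] {V : Matrix ι (Fin n) ℝ} (hV : gramDet V ≠ 0)
    {W : Matrix μ (Fin n) ℝ} {C : Matrix ι μ ℝ} (hC : V = C * W) :
    Fintype.card ι ≤ Fintype.card μ := by
  rw [gramDet_ne_zero_iff, ← vecMul_injective_iff] at hV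
  have hinj : Function.Injective C.vecMulLinear := by
    intro v w hvw
    apply hV
    simp only [hC, ← vecMul_vecMul]
    exact congrArg (· ᵥ* W) hvw
  have := LinearMap.finrank_le_finrank_of_injective hinj
  simpa using this

lemma card_le_dim {V : Matrix ι (Fin n) ℝ} (hV : gramDet V ≠ 0) : Fintype.card ι ≤ n := by
  simpa using card_le_of_eq_mul hV (Matrix.mul_one V).symm

lemma latVol_reindex (h : Matrix (Fin n) (Fin n) ℝ) (m : Matrix κ (Fin n) ℤ) (e : ι ≃ κ) :
    latVol h (m.submatrix e id) = latVol h m := by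
  rw [latVol, latVol, ← gramDet_submatrix_equiv (toReal m * hᵀ) e]
  congr 1

lemma gramDet_toReal_reindex (m : Matrix κ (Fin n) ℤ) (e : ι ≃ κ) :
    gramDet (toReal (m.submatrix e id)) = gramDet (toReal m) := by
  rw [← gramDet_submatrix_equiv (toReal m) e]
  congr 1

/-- Passing to a tuple generating a larger group of the same rank decreases the covolume. -/
lemma latVol_le_of_eq_mul (h : Matrix (Fin n) (Fin n) ℝ) {m : Matrix ι (Fin n) ℤ}
    (hm : gramDet (toReal m) ≠ 0) {m' : Matrix κ (Fin n) ℤ} {U : Matrix ι κ ℤ} (hU : m = U * m')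
    (hcard : Fintype.card ι = Fintype.card κ) : latVol h m' ≤ latVol h m := by
  let e : ι ≃ κ := Fintype.equivOfCardEq hcard
  have hU' : m = U.submatrix id e * m'.submatrix e id := by
    rw [submatrix_mul_equiv]; simpa using hU
  have h1 : latVol h m = (toReal (U.submatrix id e)).det ^ 2 * latVol h m' := by
    rw [← latVol_reindex h m' e, latVol, latVol, hU', toReal_mul, Matrix.mul_assoc, gramDet_mul]
  have h2 : (toReal (U.submatrix id e)).det ≠ 0 := by
    intro h0
    apply hm
    rw [hU', toReal_mul, gramDet_mul, h0]; simp
  have h3 : 1 ≤ (toReal (U.submatrix id e)).det ^ 2 := by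
    rw [det_toReal] at h2 ⊢
    rw [Int.cast_ne_zero] at h2
    have : 0 < (U.submatrix id e).det ^ 2 := by positivity
    exact_mod_cast this
  rw [h1]
  nlinarith [show 0 ≤ latVol h m' from gramDet_nonneg _]

/-- `GoodAt c θ h` bounds the covolumes of the subgroups of `h ℤⁿ` from below, with a weight which
makes the bound strictly submodular. -/
def GoodAt (c θ : ℝ) (h : Matrix (Fin n) (Fin n) ℝ) : Prop :=
  ∀ (r : ℕ) (m : Matrix (Fin r) (Fin n) ℤ), gramDet (toReal m) ≠ 0 →
    c ≤ latVol h m * θ ^ (r * (n - r))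

lemma GoodAt.le {c θ : ℝ} {h : Matrix (Fin n) (Fin n) ℝ} (hg : GoodAt c θ h)
    {m : Matrix ι (Fin n) ℤ} (hm : gramDet (toReal m) ≠ 0) :
    c ≤ latVol h m * θ ^ (Fintype.card ι * (n - Fintype.card ι)) := by
  let e := (Fintype.equivFin ι).symm
  have := hg _ (m.submatrix e id) (by rwa [gramDet_toReal_reindex])
  rwa [latVol_reindex] at this

end IntTuple

section Complement

/-- The integer vectors in the real row space of an integer matrix. -/
def rowSat {n : ℕ} {ι : Type*} [Fintype ι] (m : Matrix ι (Fin n) ℤ) :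
    Submodule ℤ (Fin n → ℤ) where
  carrier := {z | ∃ w : ι → ℝ, w ᵥ* toReal m = fun i => (z i : ℝ)}
  zero_mem' := ⟨0, by ext; simp⟩
  add_mem' := by
    rintro a b ⟨w, hw⟩ ⟨u, hu⟩
    exact ⟨w + u, by rw [add_vecMul, hw, hu]; ext; simp⟩
  smul_mem' := by
    rintro c z ⟨w, hw⟩
    exact ⟨(c : ℝ) • w, by rw [smul_vecMul, hw]; ext; simp⟩

variable {n : ℕ} {ι κ : Type*}

lemma mem_rowSat_of_smul_mem [Fintype ι] {m : Matrix ι (Fin n) ℤ} {c : ℤ} (hc : c ≠ 0)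
    {z : Fin n → ℤ}
    (hz : c • z ∈ rowSat m) : z ∈ rowSat m := by
  obtain ⟨w, hw⟩ := hz
  refine ⟨(c : ℝ)⁻¹ • w, ?_⟩
  rw [smul_vecMul, hw]
  ext i
  have : (c : ℝ) ≠ 0 := by exact_mod_cast hc
  simp [this]

lemma row_mem_rowSat [Fintype ι] [DecidableEq ι] (m : Matrix ι (Fin n) ℤ) (i : ι) : m i ∈ rowSat m :=
  ⟨Pi.single i 1, by ext k; simp⟩

lemma eq_mul_of_mem_rowSat [Fintype κ] {m : Matrix ι (Fin n) ℤ} {m' : Matrix κ (Fin n) ℤ}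
    (h : ∀ i, m i ∈ rowSat m') : ∃ C : Matrix ι κ ℝ, toReal m = C * toReal m' := by
  choose w hw using h
  refine ⟨of w, ?_⟩
  ext i k
  have := congrFun (hw i) k
  rw [toReal_apply, ← this, mul_apply_eq_vecMul]
  rfl

lemma eq_mul_of_mem_span [Fintype κ] {m : Matrix ι (Fin n) ℤ} {m' : Matrix κ (Fin n) ℤ}
    (h : ∀ i, m i ∈ Submodule.span ℤ (Set.range m'.row)) : ∃ U : Matrix ι κ ℤ, m = U * m' := by
  simp_rw [Submodule.mem_span_range_iff_exists_fun] at h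
  choose c hc using h
  refine ⟨of c, ?_⟩
  ext i k
  rw [← hc i, mul_apply, Finset.sum_apply]
  rfl

/-- A subgroup of a free abelian group of finite rank has a complement in any larger subgroup in
which it is saturated. -/
lemma exists_complement {I S : Submodule ℤ (Fin n → ℤ)} (hIS : I ≤ S)
    (hsat : ∀ (c : ℤ) z, c ≠ 0 → z ∈ S → c • z ∈ I → z ∈ I) :
    ∃ C : Submodule ℤ (Fin n → ℤ), I ⊓ C = ⊥ ∧ I ⊔ C = S := by
  set J : Submodule ℤ S := I.comap S.subtype with hJ
  have htf : Module.IsTorsionFree ℤ (S ⧸ J) := by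
    rw [Module.isTorsionFree_iff_smul_eq_zero]
    intro c x hcx
    obtain ⟨z, rfl⟩ := J.mkQ_surjective x
    by_cases hc : c = 0
    · exact Or.inl hc
    · right
      rw [← map_smul] at hcx
      simp only [Submodule.mkQ_apply, Submodule.Quotient.mk_eq_zero] at hcx ⊢
      exact hsat c z hc z.2 (by simpa [hJ] using hcx)
  have : Module.Free ℤ (S ⧸ J) := Module.free_of_finite_type_torsion_free'
  obtain ⟨σ, hσ⟩ := LinearMap.exists_rightInverse_of_surjective J.mkQ J.range_mkQ
  have hσ' : ∀ x, J.mkQ (σ x) = x := fun x => LinearMap.congr_fun hσ x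
  refine ⟨(LinearMap.range σ).map S.subtype, ?_, ?_⟩
  · rw [eq_bot_iff]
    rintro z ⟨hz, y, ⟨x, rfl⟩, rfl⟩
    have h1 : J.mkQ (σ x) = 0 := by
      rw [Submodule.mkQ_apply, Submodule.Quotient.mk_eq_zero]; exact hz
    rw [hσ'] at h1
    rw [h1]; simp
  · apply le_antisymm
    · refine sup_le hIS ?_
      rintro z ⟨y, -, rfl⟩
      exact y.2
    · intro z hz
      set y : S := ⟨z, hz⟩
      have h1 : y - σ (J.mkQ y) ∈ J := by
        rw [← Submodule.Quotient.mk_eq_zero, ← Submodule.mkQ_apply, map_sub, hσ', sub_self]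
      have h2 : z = (y - σ (J.mkQ y) : S) + (σ (J.mkQ y) : S) := by simp [y]
      rw [h2]
      exact Submodule.add_mem_sup h1 ⟨_, ⟨_, rfl⟩, rfl⟩

/-- Every subgroup of `ℤⁿ` is generated by an independent tuple. -/
lemma exists_basis_matrix (I : Submodule ℤ (Fin n → ℤ)) :
    ∃ (r : ℕ) (m : Matrix (Fin r) (Fin n) ℤ), LinearIndependent ℤ m.row ∧
      Submodule.span ℤ (Set.range m.row) = I := by
  obtain ⟨r, b⟩ := Submodule.basisOfPid (Pi.basisFun ℤ (Fin n)) I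
  refine ⟨r, of fun i => (b i : Fin n → ℤ), ?_, ?_⟩
  · exact b.linearIndependent.map' I.subtype I.ker_subtype
  · have := congrArg (Submodule.map I.subtype) b.span_eq
    rw [Submodule.map_span, Submodule.map_subtype_top, ← Set.range_comp] at this
    exact this

end Complement

/-! ### Near-minimal subgroups form a chain -/

section NearMin

variable {n : ℕ}

/-- If `i, a` generates the saturation of `m` then it has smaller covolume than `m`. -/
lemma latVol_fromRows_le (h : Matrix (Fin n) (Fin n) ℝ) {r k p : ℕ} {m : Matrix (Fin r) (Fin n) ℤ}
    (hm : gramDet (toReal m) ≠ 0) {i : Matrix (Fin k) (Fin n) ℤ} {a : Matrix (Fin p) (Fin n) ℤ}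
    (hia : gramDet (toReal (fromRows i a)) ≠ 0)
    (hspan : Submodule.span ℤ (Set.range (fromRows i a).row) = rowSat m) :
    r = k + p ∧ latVol h (fromRows i a) ≤ latVol h m := by
  obtain ⟨U, hU⟩ := eq_mul_of_mem_span (m := m) (m' := fromRows i a) fun j => by
    rw [hspan]; exact row_mem_rowSat m j
  obtain ⟨C, hC⟩ := eq_mul_of_mem_rowSat (m := fromRows i a) (m' := m) fun j => by
    rw [← hspan]; exact Submodule.subset_span ⟨j, rfl⟩
  have h1 := card_le_of_eq_mul hia hC
  have h2 := card_le_of_eq_mul (W := toReal (fromRows i a)) (C := toReal U) hm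
    (by rw [← toReal_mul, ← hU])
  simp only [Fintype.card_sum, Fintype.card_fin] at h1 h2
  exact ⟨by omega, latVol_le_of_eq_mul h hm hU (by simp; omega)⟩

lemma toReal_fromRows {ι κ μ : Type*} (m : Matrix ι μ ℤ) (m' : Matrix κ μ ℤ) :
    toReal (fromRows m m') = fromRows (toReal m) (toReal m') := by
  rw [toReal, fromRows_map]; rfl

lemma span_fromRows {ι κ : Type*} (m : Matrix ι (Fin n) ℤ) (m' : Matrix κ (Fin n) ℤ) :
    Submodule.span ℤ (Set.range (fromRows m m').row)
      = Submodule.span ℤ (Set.range m.row) ⊔ Submodule.span ℤ (Set.range m'.row) := by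
  rw [← Submodule.span_union, ← Set.Sum.elim_range]
  rfl

lemma linearIndependent_fromRows {ι κ : Type*} {m : Matrix ι (Fin n) ℤ} {m' : Matrix κ (Fin n) ℤ}
    (hm : LinearIndependent ℤ m.row) (hm' : LinearIndependent ℤ m'.row)
    (h : Submodule.span ℤ (Set.range m.row) ⊓ Submodule.span ℤ (Set.range m'.row) = ⊥) :
    LinearIndependent ℤ (fromRows m m').row :=
  hm.sum_type hm' (disjoint_iff.mpr h)

/-- Submodularity for integer tuples. -/
lemma latVol_submodular {ι κ μ : Type*} [Fintype ι] [DecidableEq ι] [Fintype κ] [DecidableEq κ]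
    [Fintype μ] [DecidableEq μ] {h : Matrix (Fin n) (Fin n) ℝ} (hh : h.det ≠ 0)
    {i : Matrix ι (Fin n) ℤ} {a : Matrix κ (Fin n) ℤ} (b : Matrix μ (Fin n) ℤ)
    (hi : gramDet (toReal i) ≠ 0) (hia : gramDet (toReal (fromRows i a)) ≠ 0) :
    latVol h (fromRows (fromRows i a) b) * latVol h i
      ≤ latVol h (fromRows i a) * latVol h (fromRows i b) := by
  have h1 := (latVol_pos hh hi).ne'
  have h2 := (latVol_pos hh hia).ne'
  simp only [latVol, toReal_fromRows, fromRows_mul] at h1 h2 ⊢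
  exact gramDet_submodular h1 h2 _

/-- Two near-minimal subgroups are nested. -/
lemma exists_eq_mul_of_nearMin {s θ : ℝ} (hs : 0 < s) (hθ : 1 < θ)
    {h : Matrix (Fin n) (Fin n) ℝ} (hh : h.det ≠ 0) (hgood : GoodAt s θ h) {r₁ r₂ : ℕ}
    (hr : r₁ ≤ r₂) {m₁ : Matrix (Fin r₁) (Fin n) ℤ} {m₂ : Matrix (Fin r₂) (Fin n) ℤ}
    (hm₁ : gramDet (toReal m₁) ≠ 0) (hm₂ : gramDet (toReal m₂) ≠ 0)
    (h₁ : latVol h m₁ * θ ^ (r₁ * (n - r₁)) < θ * s)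
    (h₂ : latVol h m₂ * θ ^ (r₂ * (n - r₂)) < θ * s) :
    ∃ C : Matrix (Fin r₁) (Fin r₂) ℝ, toReal m₁ = C * toReal m₂ := by
  set S₁ := rowSat m₁ with hS₁
  set S₂ := rowSat m₂ with hS₂
  obtain ⟨C₁, hC₁, hC₁'⟩ := exists_complement (I := S₁ ⊓ S₂) (S := S₁) inf_le_left
    fun c z hc hz hcz => ⟨hz, mem_rowSat_of_smul_mem hc hcz.2⟩
  obtain ⟨C₂, hC₂, hC₂'⟩ := exists_complement (I := S₁ ⊓ S₂) (S := S₂) inf_le_right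
    fun c z hc hz hcz => ⟨mem_rowSat_of_smul_mem hc hcz.1, hz⟩
  obtain ⟨k, i, hi, hispan⟩ := exists_basis_matrix (S₁ ⊓ S₂)
  obtain ⟨p, a, ha, haspan⟩ := exists_basis_matrix C₁
  obtain ⟨q, b, hb, hbspan⟩ := exists_basis_matrix C₂
  have hia : LinearIndependent ℤ (fromRows i a).row :=
    linearIndependent_fromRows hi ha (by rw [hispan, haspan, hC₁])
  have hiaspan : Submodule.span ℤ (Set.range (fromRows i a).row) = S₁ := by
    rw [span_fromRows, hispan, haspan, hC₁']
  have hib : LinearIndependent ℤ (fromRows i b).row :=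
    linearIndependent_fromRows hi hb (by rw [hispan, hbspan, hC₂])
  have hibspan : Submodule.span ℤ (Set.range (fromRows i b).row) = S₂ := by
    rw [span_fromRows, hispan, hbspan, hC₂']
  have hiab : LinearIndependent ℤ (fromRows (fromRows i a) b).row := by
    refine linearIndependent_fromRows hia hb ?_
    rw [hiaspan, hbspan, eq_bot_iff, ← hC₂]
    have h3 : C₂ ≤ S₂ := by rw [← hC₂']; exact le_sup_right
    exact fun z hz => ⟨⟨hz.1, h3 hz.2⟩, hz.2⟩
  rw [← gramDet_toReal_ne_zero_iff] at hi hia hib hiab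
  obtain ⟨hr₁, hv₁⟩ := latVol_fromRows_le h hm₁ hia hiaspan
  obtain ⟨hr₂, hv₂⟩ := latVol_fromRows_le h hm₂ hib hibspan
  by_cases hp : p = 0
  · subst hp
    have h3 : C₁ = ⊥ := by
      rw [← haspan, Set.range_eq_empty, Submodule.span_empty]
    refine eq_mul_of_mem_rowSat fun j => ?_
    have h4 : m₁ j ∈ S₁ := row_mem_rowSat m₁ j
    rw [← hC₁', h3, sup_bot_eq] at h4
    exact h4.2
  · exfalso
    have hq : 1 ≤ q := by omega
    have hp : 1 ≤ p := by omega
    have hsub := latVol_submodular hh b hi hia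
    have hn := card_le_dim hiab
    have hg₁ := hgood.le hiab
    have hg₂ := hgood.le hi
    simp only [Fintype.card_sum, Fintype.card_fin] at hn hg₁ hg₂
    have hexp : r₁ * (n - r₁) + r₂ * (n - r₂)
        = (k + p + q) * (n - (k + p + q)) + k * (n - k) + 2 * (p * q) := by
      obtain ⟨d, rfl⟩ := Nat.exists_eq_add_of_le hn
      subst hr₁ hr₂
      rw [show k + p + q + d - (k + p) = q + d by omega,
        show k + p + q + d - (k + q) = p + d by omega,
        show k + p + q + d - (k + p + q) = d by omega,
        show k + p + q + d - k = p + q + d by omega]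
      ring
    set e₁ := r₁ * (n - r₁)
    set e₂ := r₂ * (n - r₂)
    set f₁ := (k + p + q) * (n - (k + p + q))
    set f₂ := k * (n - k)
    have hθ0 : 0 < θ := by linarith
    have hvi := latVol_pos hh hi
    have hvm₁ := latVol_pos hh hm₁
    have hvm₂ := latVol_pos hh hm₂
    have hvib := latVol_pos hh hib
    have hviab := latVol_pos hh hiab
    have k1 : s * s ≤ (latVol h (fromRows (fromRows i a) b) * θ ^ f₁) * (latVol h i * θ ^ f₂) :=
      mul_le_mul hg₁ hg₂ hs.le (by positivity)
    have k2 : (latVol h m₁ * θ ^ e₁) * (latVol h m₂ * θ ^ e₂) < (θ * s) * (θ * s) :=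
      mul_lt_mul'' h₁ h₂ (by positivity) (by positivity)
    have k3 : latVol h (fromRows (fromRows i a) b) * latVol h i ≤ latVol h m₁ * latVol h m₂ :=
      hsub.trans (mul_le_mul hv₁ hv₂ hvib.le hvm₁.le)
    have k4 : θ ^ 2 ≤ θ ^ (2 * (p * q)) :=
      pow_le_pow_right₀ hθ.le (by have := Nat.mul_le_mul hp hq; omega)
    have k5 : (latVol h m₁ * θ ^ e₁) * (latVol h m₂ * θ ^ e₂)
        = (latVol h m₁ * latVol h m₂) * (θ ^ f₁ * θ ^ f₂) * θ ^ (2 * (p * q)) := by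
      have : θ ^ e₁ * θ ^ e₂ = θ ^ f₁ * θ ^ f₂ * θ ^ (2 * (p * q)) := by
        rw [← pow_add, hexp, pow_add, pow_add]
      linear_combination (latVol h m₁ * latVol h m₂) * this
    have k6 : s * s ≤ (latVol h m₁ * latVol h m₂) * (θ ^ f₁ * θ ^ f₂) := by
      refine k1.trans ?_
      have := mul_le_mul_of_nonneg_right k3 (show 0 ≤ θ ^ f₁ * θ ^ f₂ by positivity)
      linarith
    have k7 : (s * s) * θ ^ 2 ≤ (latVol h m₁ * latVol h m₂) * (θ ^ f₁ * θ ^ f₂) * θ ^ (2 * (p * q)) :=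
      mul_le_mul k6 k4 (by positivity) (by positivity)
    rw [k5] at k2
    nlinarith

end NearMin

/-! ### Reduced bases -/

section Reduction

variable {n : ℕ}

lemma exists_gramSchmidt_decomposition {X : Matrix (Fin n) (Fin n) ℝ} (hX : X.det ≠ 0) :
    ∃ (M U : Matrix (Fin n) (Fin n) ℝ) (δ : Fin n → ℝ), X = M * U ∧ (∀ i, M i i = 1) ∧
      (∀ i j, i < j → M i j = 0) ∧ U * Uᵀ = diagonal δ ∧ ∀ i, 0 < δ i := by
  set f : Fin n → EuclideanSpace ℝ (Fin n) := fun i => WithLp.toLp 2 (X i) with hf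
  set u := InnerProductSpace.gramSchmidt ℝ f with hu
  have hli : LinearIndependent ℝ f := by
    have h := linearIndependent_rows_of_det_ne_zero hX
    exact h.map' (WithLp.linearEquiv 2 ℝ (Fin n → ℝ)).symm.toLinearMap (LinearEquiv.ker _)
  have hinner : ∀ i j, inner ℝ (u i) (u j) = ∑ k, u i k * u j k := by
    intro i j
    rw [PiLp.inner_apply]
    refine Finset.sum_congr rfl fun k _ => ?_
    rw [RCLike.inner_apply', RCLike.conj_to_real]
  refine ⟨of fun i j => if i = j then 1 else if j < i then
      inner ℝ (u j) (f i) / (‖u j‖ ^ 2) else 0, of fun i k => u i k, fun i => inner ℝ (u i) (u i),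
      ?_, ?_, ?_, ?_, ?_⟩
  · ext i k
    have h := InnerProductSpace.gramSchmidt_def'' ℝ f i
    have h2 := congrArg (fun v : EuclideanSpace ℝ (Fin n) => v k) h
    simp only [PiLp.add_apply, WithLp.ofLp_sum, Finset.sum_apply, PiLp.smul_apply, smul_eq_mul] at h2
    rw [mul_apply, ← Finset.add_sum_erase _ _ (Finset.mem_univ i)]
    simp only [of_apply, if_true, one_mul]
    rw [show X i k = f i k from rfl, h2]
    congr 1
    refine (Finset.sum_congr rfl fun j hj => ?_).trans (Finset.sum_subset ?_ ?_)
    · rw [Finset.mem_Iio] at hj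
      rw [if_neg hj.ne', if_pos hj]; rfl
    · intro j hj
      simp [(Finset.mem_Iio.mp hj).ne]
    · intro j hj hj'
      rw [Finset.mem_Iio] at hj'
      rw [if_neg (Finset.ne_of_mem_erase hj).symm, if_neg hj', zero_mul]
  · intro i; simp
  · intro i j hij; simp [hij.ne, hij.not_gt]
  · ext i j
    rw [mul_apply, diagonal_apply]
    simp only [transpose_apply, of_apply]
    rw [← hinner]
    split_ifs with hij
    · rw [hij]
    · exact InnerProductSpace.gramSchmidt_orthogonal ℝ f hij
  · intro i
    exact real_inner_self_pos.mpr (InnerProductSpace.gramSchmidt_ne_zero i hli)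

lemma det_of_unitriangular {ι R : Type*} [Fintype ι] [DecidableEq ι] [LinearOrder ι] [CommRing R]
    {T : Matrix ι ι R} (h1 : ∀ i, T i i = 1) (h0 : ∀ i j, i < j → T i j = 0) : T.det = 1 := by
  rw [det_of_isLowerTriangular T fun i j hij => h0 i j hij]
  simp [h1]

/-- Size reduction of a single row. -/
lemma exists_size_reduced_row {M : Matrix (Fin n) (Fin n) ℝ} (h1 : ∀ i, M i i = 1)
    (h0 : ∀ i j, i < j → M i j = 0) (i : Fin n) (d : ℕ) :
    ∃ t : Fin n → ℤ, t i = 1 ∧ (∀ k, i < k → t k = 0) ∧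
      ∀ j, j < i → (i : ℕ) ≤ j + d → |∑ k, (t k : ℝ) * M k j| ≤ 1 / 2 := by
  induction d with
  | zero =>
    refine ⟨Pi.single i 1, by simp, fun k hk => by simp [hk.ne'], fun j hj hij => ?_⟩
    exact absurd hij (by simpa using hj)
  | succ d ih =>
    obtain ⟨t, ht1, ht0, ht⟩ := ih
    by_cases hd : d + 1 ≤ (i : ℕ)
    · set p : Fin n := ⟨i - (d + 1), by omega⟩ with hp
      have hpi : p < i := by rw [Fin.lt_def]; simp only [hp]; omega
      set c := round (∑ k, (t k : ℝ) * M k p) with hc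
      have hsum : ∀ j, ∑ k, (((t - Pi.single p c : Fin n → ℤ) k : ℤ) : ℝ) * M k j
          = ∑ k, (t k : ℝ) * M k j - c * M p j := by
        intro j
        have : ∀ k, (((t - Pi.single p c : Fin n → ℤ) k : ℤ) : ℝ) * M k j
            = (t k : ℝ) * M k j - if k = p then c * M p j else 0 := by
          intro k
          by_cases hk : k = p
          · subst hk; simp; ring
          · simp [hk]
        simp_rw [this, Finset.sum_sub_distrib]
        simp
      refine ⟨t - Pi.single p c, ?_, ?_, ?_⟩
      · simp [ht1, hpi.ne']
      · intro k hk; simp [ht0 k hk, (hpi.trans hk).ne']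
      · intro j hj hij
        rw [hsum j]
        by_cases hjp : j = p
        · subst hjp
          rw [h1, mul_one]
          exact abs_sub_round _
        · have : p < j := by
            rw [Fin.lt_def]; simp only [hp]
            have : (j : ℕ) ≠ i - (d + 1) := fun h => hjp (Fin.ext h)
            omega
          rw [h0 p j this, mul_zero, sub_zero]
          refine ht j hj ?_
          have : (i : ℕ) - (d + 1) < j := this
          omega
    · exact ⟨t, ht1, ht0, fun j hj hij => ht j hj (by omega)⟩

lemma exists_size_reduction {M : Matrix (Fin n) (Fin n) ℝ} (h1 : ∀ i, M i i = 1)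
    (h0 : ∀ i j, i < j → M i j = 0) :
    ∃ T : Matrix (Fin n) (Fin n) ℤ, T.det = 1 ∧ (∀ i, (toReal T * M) i i = 1) ∧
      (∀ i j, i < j → (toReal T * M) i j = 0) ∧ ∀ i j, j < i → |(toReal T * M) i j| ≤ 1 / 2 := by
  choose t ht1 ht0 ht using fun i => exists_size_reduced_row h1 h0 i n
  refine ⟨of t, det_of_unitriangular ht1 ht0, fun i => ?_, fun i j hij => ?_, fun i j hij => ?_⟩
  · rw [mul_apply, Finset.sum_eq_single i]
    · simp [ht1, h1]
    · intro k _ hk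
      rcases lt_or_gt_of_ne hk with h | h
      · simp [h0 k i h]
      · simp [ht0 i k h]
    · simp
  · rw [mul_apply]
    refine Finset.sum_eq_zero fun k _ => ?_
    rcases lt_or_ge k j with h | h
    · simp [h0 k j h]
    · simp [ht0 i k (hij.trans_le h)]
  · exact ht i j hij (by omega)

lemma gramDet_unitriangular_mul {ι : Type*} [Fintype ι] [DecidableEq ι] [LinearOrder ι]
    {T : Matrix ι ι ℝ} (h1 : ∀ i, T i i = 1) (h0 : ∀ i j, i < j → T i j = 0)
    {W : Matrix ι (Fin n) ℝ} {δ : ι → ℝ} (hW : W * Wᵀ = diagonal δ) :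
    gramDet (T * W) = ∏ i, δ i := by
  rw [gramDet_mul, det_of_unitriangular h1 h0, gramDet, hW, det_diagonal]; simp

end Reduction

section LeadVol

variable {n : ℕ}

/-- The squared covolume of the first `k` rows of a matrix. -/
def leadVol (X : Matrix (Fin n) (Fin n) ℝ) (k : ℕ) : ℝ :=
  gramDet (X.submatrix (fun i : {i : Fin n // (i : ℕ) < k} => i.1) id)

lemma leadVol_mul {M U : Matrix (Fin n) (Fin n) ℝ} {δ : Fin n → ℝ} (h1 : ∀ i, M i i = 1)
    (h0 : ∀ i j, i < j → M i j = 0) (hU : U * Uᵀ = diagonal δ) (k : ℕ) :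
    leadVol (M * U) k = ∏ i : {i : Fin n // (i : ℕ) < k}, δ i := by
  have hX : (M * U).submatrix (fun i : {i : Fin n // (i : ℕ) < k} => i.1) id =
      M.submatrix (fun i : {i : Fin n // (i : ℕ) < k} => i.1)
          (fun i : {i : Fin n // (i : ℕ) < k} => i.1) *
        U.submatrix (fun i : {i : Fin n // (i : ℕ) < k} => i.1) id := by
    ext i l
    simp only [submatrix_apply, mul_apply, id]
    rw [← Fintype.sum_subtype_add_sum_subtype (fun j : Fin n => (j : ℕ) < k)]
    refine add_eq_left.mpr ?_
    refine Finset.sum_eq_zero fun j _ => ?_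
    have hij : i.1 < j.1 := by
      have h1 := i.2
      have h2 := j.2
      rw [Fin.lt_def]; omega
    rw [h0 _ _ hij, zero_mul]
  rw [leadVol, hX]
  refine gramDet_unitriangular_mul (T := M.submatrix (fun i : {i : Fin n // (i : ℕ) < k} => i.1)
    (fun i : {i : Fin n // (i : ℕ) < k} => i.1)) (fun i => h1 i)
    (fun i j hij => h0 i j hij) ?_
  ext i j
  have := congrFun (congrFun hU i) j
  simpa [mul_apply, diagonal_apply, Subtype.ext_iff] using this

lemma leadVol_swap_of_ne (X : Matrix (Fin n) (Fin n) ℝ) {j j' : Fin n} (hj : (j' : ℕ) = j + 1)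
    {k : ℕ} (hk : k ≠ j + 1) : leadVol (X.submatrix (Equiv.swap j j') id) k = leadVol X k := by
  have he : ∀ i : Fin n, (i : ℕ) < k ↔ ((Equiv.swap j j' i : Fin n) : ℕ) < k := by
    intro i
    rw [Equiv.swap_apply_def]
    split_ifs with h1 h2
    · subst h1; omega
    · subst h2; omega
    · rfl
  exact gramDet_submatrix_equiv (X.submatrix (fun i : {i : Fin n // (i : ℕ) < k} => i.1) id)
    ((Equiv.swap j j').subtypeEquiv he)

lemma leadVol_swap {M U : Matrix (Fin n) (Fin n) ℝ} {δ : Fin n → ℝ} (h1 : ∀ i, M i i = 1)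
    (h0 : ∀ i j, i < j → M i j = 0) (hU : U * Uᵀ = diagonal δ) {j j' : Fin n}
    (hj : (j' : ℕ) = j + 1) :
    leadVol ((M * U).submatrix (Equiv.swap j j') id) (j + 1) * δ j =
      leadVol (M * U) (j + 1) * (δ j' + M j' j ^ 2 * δ j) := by
  have hjj : j < j' := by rw [Fin.lt_def]; omega
  have hUe : ∀ a b, ∑ l, U a l * U b l = if a = b then δ a else 0 := by
    intro a b
    simpa [mul_apply, diagonal_apply] using congrFun (congrFun hU a) b
  have hsw : ∀ i : {i : Fin n // (i : ℕ) < j + 1}, i.1 ≠ j → Equiv.swap j j' i.1 = i.1 := by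
    intro i hi
    refine Equiv.swap_apply_of_ne_of_ne hi fun h => ?_
    have := i.2
    rw [h] at this; omega
  have hX : ((M * U).submatrix (Equiv.swap j j') id).submatrix
      (fun i : {i : Fin n // (i : ℕ) < j + 1} => i.1) id =
      (of fun i k : {i : Fin n // (i : ℕ) < j + 1} =>
        if i = k then 1 else M (Equiv.swap j j' i.1) k.1) *
      (of fun (k : {i : Fin n // (i : ℕ) < j + 1}) l =>
        if k.1 = j then U j' l + M j' j * U j l else U k.1 l) := by
    ext i l
    simp only [submatrix_apply, mul_apply, id, of_apply]
    rw [← Fintype.sum_subtype_add_sum_subtype (fun k : Fin n => (k : ℕ) < j + 1)]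
    by_cases hi : i.1 = j
    · have hrest : ∑ k : {k : Fin n // ¬ (k : ℕ) < j + 1}, M (Equiv.swap j j' i.1) k * U k l =
          U j' l := by
        rw [Finset.sum_eq_single ⟨j', by omega⟩]
        · rw [hi, Equiv.swap_apply_left, h1, one_mul]
        · rintro ⟨k, hk⟩ _ hne
          rw [hi, Equiv.swap_apply_left, h0, zero_mul]
          have : k ≠ j' := fun h => hne (Subtype.ext h)
          have : (k : ℕ) ≠ j' := fun h => this (Fin.ext h)
          rw [Fin.lt_def]; change (j' : ℕ) < k; omega
        · simp
      rw [hrest, ← Finset.sum_erase_add _ _ (Finset.mem_univ i),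
        ← Finset.sum_erase_add _ _ (Finset.mem_univ i), add_assoc]
      congr 1
      · refine Finset.sum_congr rfl fun k hk => ?_
        have hki := Finset.ne_of_mem_erase hk
        rw [if_neg hki.symm, if_neg fun h => hki (Subtype.ext (h.trans hi.symm))]
      · rw [if_pos rfl, if_pos hi, hi, Equiv.swap_apply_left]; ring
    · have hij : i.1 < j := by
        have := i.2
        have : (i.1 : ℕ) ≠ j := fun h => hi (Fin.ext h)
        rw [Fin.lt_def]; omega
      have hrest : ∑ k : {k : Fin n // ¬ (k : ℕ) < j + 1}, M (Equiv.swap j j' i.1) k * U k l =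
          0 := by
        refine Finset.sum_eq_zero fun k _ => ?_
        rw [hsw i hi, h0, zero_mul]
        have := k.2
        rw [Fin.lt_def] at hij ⊢; omega
      rw [hrest, add_zero]
      refine Finset.sum_congr rfl fun k _ => ?_
      rw [hsw i hi]
      by_cases hk : k.1 = j
      · rw [if_neg fun h => hi ((congrArg Subtype.val h).trans hk), hk, h0 _ _ hij]; simp
      · rw [if_neg hk]
        split_ifs with hik
        · rw [hik, h1]
        · rfl
  rw [leadVol_mul h1 h0 hU, leadVol, hX, gramDet_unitriangular_mul
    (δ := fun i => if i.1 = j then δ j' + M j' j ^ 2 * δ j else δ i.1)]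
  · have hjm : (⟨j, by omega⟩ : {i : Fin n // (i : ℕ) < j + 1}) ∈ Finset.univ := Finset.mem_univ _
    rw [← Finset.mul_prod_erase _ _ hjm, ← Finset.mul_prod_erase _ (fun i => δ i.1) hjm, if_pos rfl,
      Finset.prod_congr rfl (g := fun i => δ i.1)]
    · ring
    · intro i hi
      rw [if_neg fun h => Finset.ne_of_mem_erase hi (Subtype.ext h)]
  · simp
  · intro i k hik
    have hik' : i.1 < k.1 := hik
    have hk := k.2
    have hi : i.1 ≠ j := fun h => by
      rw [Fin.lt_def, h] at hik'; omega
    simp [hik.ne, hsw i hi, h0 _ _ hik']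
  · ext i k
    rw [mul_apply, diagonal_apply]
    simp only [transpose_apply, of_apply]
    have hne : ∀ i : {i : Fin n // (i : ℕ) < j + 1}, i.1 ≠ j' := fun i h => by
      have := i.2
      rw [h] at this; omega
    by_cases hi : i.1 = j <;> by_cases hk : k.1 = j
    · rw [if_pos (Subtype.ext (hi.trans hk.symm))]
      simp only [hi, hk, if_true]
      calc ∑ l, (U j' l + M j' j * U j l) * (U j' l + M j' j * U j l)
          = ∑ l, U j' l * U j' l + 2 * M j' j * ∑ l, U j' l * U j l
            + M j' j ^ 2 * ∑ l, U j l * U j l := by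
            simp only [Finset.mul_sum, ← Finset.sum_add_distrib]
            exact Finset.sum_congr rfl fun l _ => by ring
        _ = _ := by rw [hUe, hUe, hUe]; simp [hjj.ne']
    · have hik : i ≠ k := fun h => hk (h ▸ hi)
      rw [if_neg hik]
      simp only [hi, hk, if_true, if_false]
      calc ∑ l, (U j' l + M j' j * U j l) * U k l
          = ∑ l, U j' l * U k l + M j' j * ∑ l, U j l * U k l := by
            simp only [Finset.mul_sum, ← Finset.sum_add_distrib]
            exact Finset.sum_congr rfl fun l _ => by ring
        _ = 0 := by rw [hUe, hUe]; simp [(hne k).symm, Ne.symm hk]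
    · have hik : i ≠ k := fun h => hi (h ▸ hk)
      rw [if_neg hik]
      simp only [hi, hk, if_true, if_false]
      calc ∑ l, U i l * (U j' l + M j' j * U j l)
          = ∑ l, U i l * U j' l + M j' j * ∑ l, U i l * U j l := by
            simp only [Finset.mul_sum, ← Finset.sum_add_distrib]
            exact Finset.sum_congr rfl fun l _ => by ring
        _ = 0 := by rw [hUe, hUe]; simp [hne i, hi]
    · simp only [hi, hk, if_false]
      rw [hUe]
      simp [Subtype.ext_iff]

end LeadVol

section ReducedBasis

variable {n : ℕ}

/-- The quantity decreased by the basis reduction algorithm. -/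
def potential (X : Matrix (Fin n) (Fin n) ℝ) : ℝ := ∏ k : Fin n, leadVol X (k + 1)

lemma le_leadVol {c : ℝ} {h : Matrix (Fin n) (Fin n) ℝ} (hgood : GoodAt c 1 h)
    {Γ : Matrix (Fin n) (Fin n) ℤ} (hΓ : Γ.det ≠ 0) (k : ℕ) :
    c ≤ leadVol (toReal Γ * hᵀ) k := by
  have h1 := hgood.le (m := Γ.submatrix (fun i : {i : Fin n // (i : ℕ) < k} => i.1) id) (by
    rw [gramDet_toReal_ne_zero_iff]
    exact (linearIndependent_rows_of_det_ne_zero hΓ).comp _ Subtype.val_injective)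
  rw [one_pow, mul_one] at h1
  exact h1

lemma potential_swap {M U : Matrix (Fin n) (Fin n) ℝ} {δ : Fin n → ℝ} (h1 : ∀ i, M i i = 1)
    (h0 : ∀ i j, i < j → M i j = 0) (hU : U * Uᵀ = diagonal δ) {j j' : Fin n}
    (hj : (j' : ℕ) = j + 1) :
    potential ((M * U).submatrix (Equiv.swap j j') id) * δ j =
      potential (M * U) * (δ j' + M j' j ^ 2 * δ j) := by
  rw [potential, potential, ← Finset.mul_prod_erase _ _ (Finset.mem_univ j),
    ← Finset.mul_prod_erase _ _ (Finset.mem_univ j), mul_right_comm, leadVol_swap h1 h0 hU hj,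
    mul_right_comm]
  congr 2
  refine Finset.prod_congr rfl fun k hk => leadVol_swap_of_ne _ hj fun h => ?_
  exact Finset.ne_of_mem_erase hk (Fin.ext (by omega))

/-- A basis of `h ℤⁿ` satisfying the Lenstra–Lenstra–Lovász conditions. -/
lemma exists_lovasz_reduced {c : ℝ} (hc : 0 < c) {h : Matrix (Fin n) (Fin n) ℝ} (hh : h.det ≠ 0)
    (hgood : GoodAt c 1 h) :
    ∃ (Γ : Matrix (Fin n) (Fin n) ℤ) (M U : Matrix (Fin n) (Fin n) ℝ) (δ : Fin n → ℝ),
      Γ.det ^ 2 = 1 ∧ toReal Γ * hᵀ = M * U ∧ (∀ i, M i i = 1) ∧ (∀ i j, i < j → M i j = 0) ∧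
      (∀ i j, j < i → |M i j| ≤ 1 / 2) ∧ U * Uᵀ = diagonal δ ∧ (∀ i, 0 < δ i) ∧
      ∀ j j' : Fin n, (j' : ℕ) = j + 1 → δ j / 2 ≤ δ j' := by
  set S : Set ℝ := {p | ∃ Γ : Matrix (Fin n) (Fin n) ℤ, Γ.det ^ 2 = 1 ∧
    potential (toReal Γ * hᵀ) = p} with hS
  have hne : ∀ Γ : Matrix (Fin n) (Fin n) ℤ, Γ.det ^ 2 = 1 → Γ.det ≠ 0 := by
    intro Γ hΓ h0
    rw [h0] at hΓ; norm_num at hΓ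
  have hSlb : ∀ p ∈ S, c ^ n ≤ p := by
    rintro p ⟨Γ, hΓ, rfl⟩
    calc c ^ n = ∏ _k : Fin n, c := by simp
      _ ≤ _ := Finset.prod_le_prod (fun _ _ => hc.le) fun k _ => le_leadVol hgood (hne Γ hΓ) _
  have hSne : S.Nonempty := ⟨_, 1, by simp, rfl⟩
  have hSpos : 0 < sInf S := lt_of_lt_of_le (pow_pos hc n) (le_csInf hSne hSlb)
  have hSbdd : BddBelow S := ⟨c ^ n, hSlb⟩
  obtain ⟨_, ⟨Γ, hΓ, rfl⟩, hlt⟩ :=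
    exists_lt_of_csInf_lt hSne (show sInf S < 4 / 3 * sInf S by linarith)
  have hX : (toReal Γ * hᵀ).det ≠ 0 := by
    rw [det_mul, det_transpose, det_toReal]
    exact mul_ne_zero (Int.cast_ne_zero.mpr (hne Γ hΓ)) hh
  obtain ⟨M, U, δ, hMU, hM1, hM0, hU, hδ⟩ := exists_gramSchmidt_decomposition hX
  obtain ⟨T, hT, hT1, hT0, hThalf⟩ := exists_size_reduction hM1 hM0
  have hX1 : toReal (T * Γ) * hᵀ = toReal T * M * U := by
    rw [toReal_mul, Matrix.mul_assoc, hMU, Matrix.mul_assoc]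
  have hdet : (T * Γ).det ^ 2 = 1 := by rw [det_mul, hT, one_mul, hΓ]
  have hpot : potential (toReal T * M * U) < 4 / 3 * sInf S := by
    refine lt_of_eq_of_lt ?_ hlt
    rw [hMU]
    exact Finset.prod_congr rfl fun k _ => by
      rw [leadVol_mul hT1 hT0 hU, leadVol_mul hM1 hM0 hU]
  refine ⟨T * Γ, toReal T * M, U, δ, hdet, hX1, hT1, hT0, hThalf, hU, hδ, fun j j' hj => ?_⟩
  have hsw := potential_swap hT1 hT0 hU hj
  have hle : sInf S ≤ potential ((toReal T * M * U).submatrix (Equiv.swap j j') id) := by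
    refine csInf_le hSbdd ⟨(T * Γ).submatrix (Equiv.swap j j') id, ?_, ?_⟩
    · rw [det_permute, mul_pow, hdet, mul_one, ← Int.cast_pow, ← Units.val_pow_eq_pow_val,
        Int.units_sq]
      simp
    · rw [← hX1]; rfl
  have hP : 0 < potential (toReal T * M * U) :=
    lt_of_lt_of_le hSpos (csInf_le hSbdd ⟨T * Γ, hdet, by rw [hX1]⟩)
  have hμ : (toReal T * M) j' j ^ 2 ≤ 1 / 4 := by
    have := hThalf j' j (by rw [Fin.lt_def]; omega)
    rw [abs_le] at this
    nlinarith
  have h3 : 3 / 4 * potential (toReal T * M * U) * δ j ≤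
      potential (toReal T * M * U) * (δ j' + 1 / 4 * δ j) := by
    calc 3 / 4 * potential (toReal T * M * U) * δ j
        ≤ potential ((toReal T * M * U).submatrix (Equiv.swap j j') id) * δ j :=
          mul_le_mul_of_nonneg_right (by linarith) (hδ j).le
      _ = potential (toReal T * M * U) * (δ j' + (toReal T * M) j' j ^ 2 * δ j) := hsw
      _ ≤ _ := by
          refine mul_le_mul_of_nonneg_left ?_ hP.le
          have := mul_le_mul_of_nonneg_right hμ (hδ j).le
          linarith
  have h4 : 3 / 4 * δ j ≤ δ j' + 1 / 4 * δ j := by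
    refine le_of_mul_le_mul_left ?_ hP
    linarith
  linarith

lemma exists_bounded_basis {c : ℝ} (hc : 0 < c) {h : Matrix (Fin n) (Fin n) ℝ} (hh : h.det = 1)
    (hgood : GoodAt c 1 h) :
    ∃ Γ : Matrix (Fin n) (Fin n) ℤ, Γ.det ^ 2 = 1 ∧
      ∀ i j, (toReal Γ * hᵀ) i j ^ 2 ≤ n * (1 / (c / 2 ^ n) ^ n) := by
  obtain ⟨Γ, M, U, δ, hΓ, hX, hM1, hM0, hMh, hU, hδ, hL⟩ :=
    exists_lovasz_reduced hc (by rw [hh]; exact one_ne_zero) hgood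
  have hΓ0 : Γ.det ≠ 0 := fun h0 => by rw [h0] at hΓ; norm_num at hΓ
  have hprod : ∏ i, δ i = 1 := by
    rw [← gramDet_unitriangular_mul hM1 hM0 hU, ← hX, gramDet_square, det_mul, det_transpose, hh,
      mul_one, det_toReal]
    exact_mod_cast hΓ
  have hc1 : c ≤ 1 := by
    have := hgood 0 (of fun i => i.elim0) (by simp [gramDet_of_isEmpty])
    simpa [latVol, gramDet_of_isEmpty] using this
  have hlow : ∀ k : ℕ, ∀ hk : k < n, c / 2 ^ k ≤ δ ⟨k, hk⟩ := by
    intro k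
    induction k with
    | zero =>
      intro hk
      have h1 := le_leadVol hgood hΓ0 1
      rw [hX, leadVol_mul hM1 hM0 hU] at h1
      let : Unique {i : Fin n // (i : ℕ) < 1} :=
        { default := ⟨⟨0, hk⟩, by simp⟩
          uniq := fun i => Subtype.ext (Fin.ext (by have := i.2; simp; omega)) }
      rw [Fintype.prod_unique] at h1
      rw [pow_zero, div_one]
      exact h1
    | succ k ih =>
      intro hk
      refine le_trans ?_ (hL ⟨k, by omega⟩ ⟨k + 1, hk⟩ rfl)
      rw [pow_succ, ← div_div]
      have := ih (by omega)
      linarith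
  set b := c / 2 ^ n with hb
  have hb0 : 0 < b := by positivity
  have hb1 : b ≤ 1 := (div_le_self hc.le (one_le_pow₀ (by norm_num))).trans hc1
  have hbδ : ∀ i, b ≤ δ i := by
    intro i
    refine le_trans ?_ (hlow i i.2)
    exact div_le_div_of_nonneg_left hc.le (by positivity)
      (pow_le_pow_right₀ (by norm_num) i.2.le)
  have hδb : ∀ i, δ i ≤ 1 / b ^ n := by
    intro i
    rw [le_div_iff₀ (by positivity), ← hprod, ← Finset.mul_prod_erase _ _ (Finset.mem_univ i)]
    refine mul_le_mul_of_nonneg_left ?_ (hδ i).le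
    calc b ^ n ≤ b ^ (n - 1) := pow_le_pow_of_le_one hb0.le hb1 (by omega)
      _ = ∏ _j ∈ Finset.univ.erase i, b := by simp
      _ ≤ _ := Finset.prod_le_prod (fun _ _ => hb0.le) fun j _ => hbδ j
  refine ⟨Γ, hΓ, fun i j => ?_⟩
  have hMM : ∀ k, M i k ^ 2 ≤ 1 := by
    intro k
    rcases lt_trichotomy i k with h | h | h
    · rw [hM0 i k h]; norm_num
    · rw [← h, hM1]; norm_num
    · have := hMh i k h
      rw [abs_le] at this
      nlinarith
  calc (toReal Γ * hᵀ) i j ^ 2 ≤ ∑ l, (M * U) i l ^ 2 := by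
        rw [hX]
        exact Finset.single_le_sum (f := fun l => (M * U) i l ^ 2) (fun l _ => sq_nonneg _)
          (Finset.mem_univ j)
    _ = (M * U * (M * U)ᵀ) i i := by
        rw [mul_apply]
        exact Finset.sum_congr rfl fun l _ => by rw [transpose_apply, sq]
    _ = (M * (U * Uᵀ) * Mᵀ) i i := by simp only [transpose_mul, Matrix.mul_assoc]
    _ = ∑ k, M i k ^ 2 * δ k := by
        rw [hU, mul_apply]
        exact Finset.sum_congr rfl fun l _ => by
          rw [mul_diagonal, transpose_apply]; ring
    _ ≤ ∑ _k : Fin n, 1 / b ^ n := Finset.sum_le_sum fun k _ =>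
        (mul_le_of_le_one_left (hδ k).le (hMM k)).trans (hδb k)
    _ = n * (1 / b ^ n) := by simp

end ReducedBasis

/-! ### Closures of `A`-orbits -/

section OrbitClosure

variable {n : ℕ}

lemma exists_bounded_basis_det_one (hn : 0 < n) {c : ℝ} (hc : 0 < c)
    {h : Matrix (Fin n) (Fin n) ℝ} (hh : h.det = 1) (hgood : GoodAt c 1 h) :
    ∃ Γ : Matrix (Fin n) (Fin n) ℤ, Γ.det = 1 ∧
      ∀ i j, (toReal Γ * hᵀ) i j ^ 2 ≤ n * (1 / (c / 2 ^ n) ^ n) := by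
  obtain ⟨Γ, hΓ, hb⟩ := exists_bounded_basis hc hh hgood
  set ε : Fin n → ℤ := Function.update 1 ⟨0, hn⟩ Γ.det with hε
  have hε2 : ∀ i, ε i ^ 2 = 1 := by
    intro i
    by_cases hi : i = ⟨0, hn⟩
    · rw [hε, hi, Function.update_self, hΓ]
    · rw [hε, Function.update_of_ne hi, Pi.one_apply, one_pow]
  refine ⟨diagonal ε * Γ, ?_, fun i j => ?_⟩
  · rw [det_mul, det_diagonal, hε, Finset.prod_update_of_mem (Finset.mem_univ _)]
    simp [← sq, hΓ]
  · have : (toReal (diagonal ε * Γ) * hᵀ) i j = ε i * (toReal Γ * hᵀ) i j := by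
      rw [mul_apply, mul_apply, Finset.mul_sum]
      exact Finset.sum_congr rfl fun k _ => by
        rw [toReal_apply, toReal_apply, diagonal_mul, Int.cast_mul, mul_assoc]
    rw [this, mul_pow]
    have h2 : (ε i : ℝ) ^ 2 = 1 := by exact_mod_cast hε2 i
    rw [h2, one_mul]
    exact hb i j

lemma transpose_toReal_mem_Gam {Γ : Matrix (Fin n) (Fin n) ℤ} (hΓ : Γ.det = 1) :
    (toReal Γ)ᵀ ∈ Gam n :=
  ⟨by rw [det_transpose, det_toReal, hΓ, Int.cast_one], fun i j => ⟨Γ j i, rfl⟩⟩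

lemma Gam_mul_mem {γ γ' : Matrix (Fin n) (Fin n) ℝ} (h : γ ∈ Gam n) (h' : γ' ∈ Gam n) :
    γ * γ' ∈ Gam n := by
  refine ⟨by rw [det_mul, h.1, h'.1, one_mul], fun i j => ?_⟩
  choose m hm using h.2
  choose m' hm' using h'.2
  exact ⟨∑ k, m i k * m' k j, by rw [mul_apply]; push_cast; simp only [hm, hm']⟩

lemma Apos_mul_mem {a a' : Matrix (Fin n) (Fin n) ℝ} (h : a ∈ Apos n) (h' : a' ∈ Apos n) :
    a * a' ∈ Apos n := by
  obtain ⟨d, hd, hp, rfl⟩ := h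
  obtain ⟨d', hd', hp', rfl⟩ := h'
  exact ⟨fun i => d i * d' i, fun i => mul_pos (hd i) (hd' i),
    by rw [Finset.prod_mul_distrib, hp, hp', one_mul], diagonal_mul_diagonal _ _⟩

lemma self_mem_AOrbit (g : Matrix (Fin n) (Fin n) ℝ) : g ∈ AOrbit g :=
  ⟨1, ⟨1, by simp, by simp, by simp⟩, 1,
    ⟨det_one, fun i j => ⟨(1 : Matrix (Fin n) (Fin n) ℤ) i j, by
      simp only [one_apply]; split_ifs <;> simp⟩⟩, by simp⟩

lemma mul_Gam_mem_closure {g h γ : Matrix (Fin n) (Fin n) ℝ} (hh : h ∈ closure (AOrbit g))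
    (hγ : γ ∈ Gam n) : h * γ ∈ closure (AOrbit g) := by
  refine map_mem_closure (f := fun p => p * γ) (by fun_prop) hh ?_
  rintro _ ⟨a, ha, γ', hγ', rfl⟩
  exact ⟨a, ha, γ' * γ, Gam_mul_mem hγ' hγ, by simp only [Matrix.mul_assoc]⟩

lemma Apos_mul_mem_closure {g h a : Matrix (Fin n) (Fin n) ℝ} (hh : h ∈ closure (AOrbit g))
    (ha : a ∈ Apos n) : a * h ∈ closure (AOrbit g) := by
  refine map_mem_closure (f := fun p => a * p) (by fun_prop) hh ?_
  rintro _ ⟨a', ha', γ, hγ, rfl⟩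
  exact ⟨a * a', Apos_mul_mem ha ha', γ, hγ, by simp only [Matrix.mul_assoc]⟩

lemma det_eq_one_of_mem_closure {g h : Matrix (Fin n) (Fin n) ℝ} (hg : g.det = 1)
    (hh : h ∈ closure (AOrbit g)) : h.det = 1 := by
  have hcl : IsClosed {p : Matrix (Fin n) (Fin n) ℝ | p.det = 1} :=
    isClosed_eq (by fun_prop) continuous_const
  refine closure_minimal ?_ hcl hh
  rintro _ ⟨a, ⟨d, _, hd, rfl⟩, γ, hγ, rfl⟩
  simp [det_mul, hg, hγ.1, hd]

lemma latVol_mul_transpose (h : Matrix (Fin n) (Fin n) ℝ) (Γ : Matrix (Fin n) (Fin n) ℤ) {r : ℕ}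
    (m : Matrix (Fin r) (Fin n) ℤ) : latVol (h * (toReal Γ)ᵀ) m = latVol h (m * Γ) := by
  rw [latVol, latVol, toReal_mul, transpose_mul, transpose_transpose, Matrix.mul_assoc]

lemma continuous_latVol {r : ℕ} (m : Matrix (Fin r) (Fin n) ℤ) :
    Continuous fun h : Matrix (Fin n) (Fin n) ℝ => latVol h m := by
  unfold latVol gramDet
  fun_prop

/-- Uniform lower bounds on the covolumes of sublattices pass to a limit in the orbit closure. -/
lemma exists_limit_latVol_ge (hn : 0 < n) {g : Matrix (Fin n) (Fin n) ℝ} (hg : g.det = 1) {c : ℝ}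
    (hc : 0 < c) {b : ℕ → ℕ → ℝ} {β : ℕ → ℝ}
    (hb : ∀ r, Tendsto (fun k => b k r) atTop (𝓝 (β r)))
    {h : ℕ → Matrix (Fin n) (Fin n) ℝ} (hmem : ∀ k, h k ∈ closure (AOrbit g))
    (hgood : ∀ k, GoodAt c 1 (h k))
    (hlow : ∀ k r (m : Matrix (Fin r) (Fin n) ℤ), gramDet (toReal m) ≠ 0 →
      b k r ≤ latVol (h k) m) :
    ∃ q ∈ closure (AOrbit g), ∀ r (m : Matrix (Fin r) (Fin n) ℤ), gramDet (toReal m) ≠ 0 →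
      β r ≤ latVol q m := by
  choose Γ hΓ hbd using fun k =>
    exists_bounded_basis_det_one hn hc (det_eq_one_of_mem_closure hg (hmem k)) (hgood k)
  set q : ℕ → Matrix (Fin n) (Fin n) ℝ := fun k => h k * (toReal (Γ k))ᵀ with hq
  have hqmem : ∀ k, q k ∈ closure (AOrbit g) := fun k =>
    mul_Gam_mem_closure (hmem k) (transpose_toReal_mem_Gam (hΓ k))
  have hqlow : ∀ k r (m : Matrix (Fin r) (Fin n) ℤ), gramDet (toReal m) ≠ 0 →
      b k r ≤ latVol (q k) m := by
    intro k r m hm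
    rw [hq, latVol_mul_transpose]
    refine hlow k r _ ?_
    rw [toReal_mul]
    refine gramDet_mul_ne_zero hm ?_
    rw [det_toReal, hΓ k]; simp
  set R : ℝ := √(n * (1 / (c / 2 ^ n) ^ n))
  have hK : IsCompact (Set.univ.pi fun _ : Fin n => Set.univ.pi fun _ : Fin n => Set.Icc (-R) R) :=
    isCompact_univ_pi fun _ => isCompact_univ_pi fun _ => isCompact_Icc
  have hqK : ∀ k, q k ∈ Set.univ.pi fun _ : Fin n => Set.univ.pi fun _ : Fin n =>
      Set.Icc (-R) R := by
    intro k i _ j _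
    have h1 : q k i j = (toReal (Γ k) * (h k)ᵀ) j i := by
      rw [hq, ← transpose_apply (toReal (Γ k) * (h k)ᵀ), transpose_mul, transpose_transpose]
    rw [h1]
    exact abs_le.mp (Real.abs_le_sqrt (hbd k j i))
  obtain ⟨p, -, φ, hφ, hlim⟩ := hK.tendsto_subseq hqK
  refine ⟨p, isClosed_closure.mem_of_tendsto hlim (Eventually.of_forall fun k => hqmem _),
    fun r m hm => ?_⟩
  have h1 : Tendsto (fun k => latVol (q (φ k)) m) atTop (𝓝 (latVol p m)) :=
    ((continuous_latVol m).tendsto p).comp hlim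
  exact le_of_tendsto_of_tendsto ((hb r).comp hφ.tendsto_atTop) h1
    (Eventually.of_forall fun k => hqlow _ r m hm)

/-- The covolumes of the subgroups of a lattice are bounded from below. -/
lemma exists_latVol_ge {g : Matrix (Fin n) (Fin n) ℝ} (hg : g.det = 1) :
    ∃ c : ℝ, 0 < c ∧ GoodAt c 1 g := by
  set B := (gᵀ)⁻¹ with hB
  have hu : IsUnit (gᵀ).det := by rw [det_transpose, hg]; exact isUnit_one
  set K : ℝ := 1 + ∑ i, ∑ j, B i j ^ 2 with hK
  have hK1 : 1 ≤ K := by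
    have : 0 ≤ ∑ i, ∑ j, B i j ^ 2 :=
      Finset.sum_nonneg fun i _ => Finset.sum_nonneg fun j _ => sq_nonneg _
    linarith
  have hpsd : (K • (1 : Matrix (Fin n) (Fin n) ℝ) - B * Bᵀ).PosSemidef := by
    refine Matrix.PosSemidef.of_dotProduct_mulVec_nonneg ?_ fun x => ?_
    · rw [IsHermitian, conjTranspose_eq_transpose_of_trivial]
      simp [transpose_mul]
    · have h1 : star x ⬝ᵥ ((K • (1 : Matrix (Fin n) (Fin n) ℝ) - B * Bᵀ) *ᵥ x) =
          K * ∑ i, x i ^ 2 - ∑ j, (∑ i, x i * B i j) ^ 2 := by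
        rw [sub_mulVec, dotProduct_sub, smul_mulVec, one_mulVec, dotProduct_smul, smul_eq_mul]
        congr 1
        · congr 1
          simp [dotProduct, sq]
        · rw [← mulVec_mulVec, dotProduct_mulVec, mulVec_transpose]
          simp [dotProduct, vecMul, sq]
      rw [h1, sub_nonneg]
      calc ∑ j, (∑ i, x i * B i j) ^ 2
          ≤ ∑ j, (∑ i, x i ^ 2) * ∑ i, B i j ^ 2 :=
            Finset.sum_le_sum fun j _ => Finset.sum_mul_sq_le_sq_mul_sq _ _ _
        _ = (∑ i, ∑ j, B i j ^ 2) * ∑ i, x i ^ 2 := by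
            rw [← Finset.mul_sum, Finset.sum_comm, mul_comm]
        _ ≤ K * ∑ i, x i ^ 2 := by
            refine mul_le_mul_of_nonneg_right (by linarith)
              (Finset.sum_nonneg fun i _ => sq_nonneg _)
  refine ⟨1 / K ^ n, by positivity, fun r m hm => ?_⟩
  rw [one_pow, mul_one, div_le_iff₀ (by positivity)]
  set V := toReal m * gᵀ with hV
  have hmV : toReal m = V * B := by
    rw [hV, hB, Matrix.mul_assoc, mul_nonsing_inv _ hu, Matrix.mul_one]
  have hr : r ≤ n := by simpa using card_le_dim hm
  calc 1 ≤ gramDet (toReal m) := one_le_gramDet_toReal hm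
    _ = (V * (B * Bᵀ) * Vᵀ).det := by
        rw [hmV, gramDet]; simp only [transpose_mul, Matrix.mul_assoc]
    _ ≤ (V * (B * Bᵀ) * Vᵀ +
          V * (K • (1 : Matrix (Fin n) (Fin n) ℝ) - B * Bᵀ) * Vᵀ).det := by
        refine det_le_det_add (posSemidef_mul_mul_transpose ?_ V)
          (posSemidef_mul_mul_transpose hpsd V)
        exact posSemidef_mul_transpose B
    _ = (K • (V * Vᵀ)).det := by
        rw [← Matrix.add_mul, ← Matrix.mul_add, add_sub_cancel]
        simp
    _ = K ^ r * gramDet V := by rw [det_smul, Fintype.card_fin, gramDet]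
    _ ≤ K ^ n * gramDet V :=
        mul_le_mul_of_nonneg_right (pow_le_pow_right₀ hK1 hr) (gramDet_nonneg V)
    _ = latVol g m * K ^ n := by rw [mul_comm, latVol]

end OrbitClosure

/-! ### Maximizing the weighted covolume bound along the orbit closure -/

section Maximize

variable {n : ℕ}

lemma GoodAt.mono {c c' θ : ℝ} {h : Matrix (Fin n) (Fin n) ℝ} (hg : GoodAt c θ h) (hc : c' ≤ c) :
    GoodAt c' θ h := fun r m hm => hc.trans (hg r m hm)

lemma GoodAt.le_one {c θ : ℝ} {h : Matrix (Fin n) (Fin n) ℝ} (hg : GoodAt c θ h) : c ≤ 1 := by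
  simpa [latVol, gramDet_of_isEmpty] using
    hg 0 (of fun i => i.elim0) (by simp [gramDet_of_isEmpty])

lemma GoodAt.of_one {c θ : ℝ} {h : Matrix (Fin n) (Fin n) ℝ} (hg : GoodAt c 1 h) (hθ : 1 ≤ θ) :
    GoodAt c θ h := by
  intro r m hm
  have h1 := hg r m hm
  rw [one_pow, mul_one] at h1
  exact h1.trans (le_mul_of_one_le_right (gramDet_nonneg _) (one_le_pow₀ hθ))

lemma GoodAt.to_one {c θ : ℝ} {h : Matrix (Fin n) (Fin n) ℝ} (hg : GoodAt c θ h) (hθ : 1 ≤ θ) :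
    GoodAt (c / θ ^ (n * n)) 1 h := by
  intro r m hm
  have hr : r ≤ n := by simpa using card_le_dim hm
  have h0 : 0 < θ := by linarith
  rw [one_pow, mul_one, div_le_iff₀ (by positivity)]
  refine (hg r m hm).trans (mul_le_mul_of_nonneg_left ?_ (gramDet_nonneg _))
  exact pow_le_pow_right₀ hθ (Nat.mul_le_mul hr (Nat.sub_le _ _))

lemma diagonal_exp_mem_Apos {t : Fin n → ℝ} (ht : ∑ i, t i = 0) :
    (diagonal fun i => Real.exp (t i)) ∈ Apos n :=
  ⟨fun i => Real.exp (t i), fun i => Real.exp_pos _, by rw [← Real.exp_sum, ht, Real.exp_zero], rfl⟩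

lemma one_le_latVol_of_square {h : Matrix (Fin n) (Fin n) ℝ} (hh : h.det = 1)
    {m : Matrix (Fin n) (Fin n) ℤ} (hm : gramDet (toReal m) ≠ 0) : 1 ≤ latVol h m := by
  refine (one_le_gramDet_toReal hm).trans_eq ?_
  rw [latVol, gramDet_square, gramDet_square, det_mul, det_transpose, hh, mul_one]

/-- A weighted covolume bound which is less than one can be improved by a small diagonal flow. -/
lemma exists_goodAt_improvement {s θ : ℝ} (hs : 0 < s) (hs1 : s < 1) (hθ : 1 < θ)
    {h : Matrix (Fin n) (Fin n) ℝ} (hh : h.det = 1) (hgood : GoodAt s θ h) :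
    ∃ a ∈ Apos n, ∃ s', s < s' ∧ GoodAt s' θ (a * h) := by
  classical
  have hθ0 : 0 < θ := by linarith
  set J : Finset ℕ := (Finset.Ioo 0 n).filter fun j => ∃ m : Matrix (Fin j) (Fin n) ℤ,
    gramDet (toReal m) ≠ 0 ∧ latVol h m * θ ^ (j * (n - j)) < θ * s with hJ
  have hex : ∀ j, ∃ m : Matrix (Fin j) (Fin n) ℤ, j ∈ J →
      gramDet (toReal m) ≠ 0 ∧ latVol h m * θ ^ (j * (n - j)) < θ * s := by
    intro j
    by_cases hj : j ∈ J
    · obtain ⟨m, hm⟩ := (Finset.mem_filter.mp hj).2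
      exact ⟨m, fun _ => hm⟩
    · exact ⟨0, fun h => absurd h hj⟩
  choose M hM using hex
  set V : ∀ j, Matrix (Fin j) (Fin n) ℝ := fun j => toReal (M j) * hᵀ with hV
  have hh0 : h.det ≠ 0 := by rw [hh]; exact one_ne_zero
  have hht : hᵀ.det ≠ 0 := by rwa [det_transpose]
  have hV0 : ∀ j ∈ J, gramDet (V j) ≠ 0 := fun j hj => gramDet_mul_ne_zero (hM j hj).1 hht
  set η : ℝ := Real.log θ / (4 * (n + 1)) with hη
  have hlog : 0 < Real.log θ := Real.log_pos hθ
  have hη0 : 0 < η := by positivity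
  obtain ⟨t, ht0, htη, htV⟩ := exists_flag_increase J
    (fun j hj => Finset.mem_Ioo.mp (Finset.mem_filter.mp hj).1) V hV0
    (fun i hi j hj hij => by
      obtain ⟨C, hC⟩ := exists_eq_mul_of_nearMin hs hθ hh0 hgood hij (hM i hi).1 (hM j hj).1
        (hM i hi).2 (hM j hj).2
      exact ⟨C, by rw [hV]; simp only; rw [hC, Matrix.mul_assoc]⟩) hη0
  set D : Matrix (Fin n) (Fin n) ℝ := diagonal fun i => Real.exp (t i) with hD
  have hDA : D ∈ Apos n := diagonal_exp_mem_Apos ht0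
  have hDh : ∀ {r : ℕ} (m : Matrix (Fin r) (Fin n) ℤ),
      latVol (D * h) m = gramDet (toReal m * hᵀ * D) := by
    intro r m
    rw [latVol, transpose_mul, hD, diagonal_transpose, Matrix.mul_assoc]
  have hDdet : (D * h).det = 1 := by
    rw [det_mul, hh, mul_one, hD, det_diagonal, ← Real.exp_sum, ht0, Real.exp_zero]
  set ρ : ℝ := Real.exp (Real.log θ / 2) with hρ
  have hρ1 : 1 < ρ := by
    rw [hρ, ← Real.exp_zero]
    exact Real.exp_lt_exp.mpr (by linarith)
  have hρθ : ρ ≤ Real.exp (-(2 * n * η)) * θ := by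
    calc ρ = Real.exp (-(Real.log θ / 2)) * Real.exp (Real.log θ) := by
          rw [hρ, ← Real.exp_add]; congr 1; ring
      _ ≤ _ := by
          rw [Real.exp_log hθ0]
          refine mul_le_mul_of_nonneg_right (Real.exp_le_exp.mpr (neg_le_neg ?_)) hθ0.le
          rw [hη, ← mul_div_assoc, div_le_div_iff₀ (by positivity) (by norm_num)]
          nlinarith
  have hs' : ∀ᶠ x in 𝓝[>] s, x < 1 ∧ x < ρ * s ∧
      ∀ j ∈ J, x < gramDet (V j * D) / gramDet (V j) * s := by
    have key : ∀ a, s < a → ∀ᶠ x in 𝓝[>] s, x < a := fun a ha =>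
      eventually_nhdsWithin_of_eventually_nhds (eventually_lt_nhds ha)
    refine (key 1 hs1).and ((key _ ?_).and ((eventually_all_finset J).mpr fun j hj => key _ ?_))
    · exact lt_mul_of_one_lt_left hs hρ1
    · refine lt_mul_of_one_lt_left hs ?_
      rw [one_lt_div (gramDet_pos (hV0 j hj))]
      exact htV j hj
  obtain ⟨s', ⟨h1, h2, h3⟩, hss'⟩ := (hs'.and eventually_mem_nhdsWithin).exists
  refine ⟨D, hDA, s', hss', fun r m hm => ?_⟩
  have hrn : r ≤ n := by simpa using card_le_dim hm
  rcases Nat.eq_zero_or_pos r with rfl | hr0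
  · simpa [latVol, gramDet_of_isEmpty] using h1.le
  rcases hrn.eq_or_lt with rfl | hrn
  · simpa using h1.le.trans (one_le_latVol_of_square hDdet hm)
  by_cases hnear : latVol h m * θ ^ (r * (n - r)) < θ * s
  · have hrJ : r ∈ J := Finset.mem_filter.mpr ⟨Finset.mem_Ioo.mpr ⟨hr0, hrn⟩, m, hm, hnear⟩
    obtain ⟨C, hC⟩ := exists_eq_mul_of_nearMin hs hθ hh0 hgood le_rfl hm (hM r hrJ).1
      hnear (hM r hrJ).2
    have e1 : latVol h m = C.det ^ 2 * gramDet (V r) := by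
      rw [latVol, hC, Matrix.mul_assoc, gramDet_mul]
    have e2 : latVol (D * h) m = C.det ^ 2 * gramDet (V r * D) := by
      rw [hDh, hC, Matrix.mul_assoc, Matrix.mul_assoc, gramDet_mul, ← Matrix.mul_assoc]
    have hVr := gramDet_pos (hV0 r hrJ)
    have e3 : latVol (D * h) m = gramDet (V r * D) / gramDet (V r) * latVol h m := by
      rw [e1, e2]; field_simp
    rw [e3, mul_assoc]
    exact (h3 r hrJ).le.trans (mul_le_mul_of_nonneg_left (hgood r m hm)
      (div_nonneg (gramDet_nonneg _) hVr.le))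
  · push Not at hnear
    have hle := exp_neg_mul_gramDet_le (gramDet_mul_ne_zero hm hht) fun i => (htη i).le
    rw [← hD, ← hDh] at hle
    calc s' ≤ ρ * s := h2.le
      _ ≤ Real.exp (-(2 * n * η)) * θ * s := mul_le_mul_of_nonneg_right hρθ hs.le
      _ ≤ Real.exp (-(2 * n * η)) * (latVol h m * θ ^ (r * (n - r))) := by
          rw [mul_assoc]
          exact mul_le_mul_of_nonneg_left hnear (Real.exp_pos _).le
      _ ≤ latVol (D * h) m * θ ^ (r * (n - r)) := by
          rw [← mul_assoc]
          exact mul_le_mul_of_nonneg_right hle (pow_pos hθ0 _).le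

lemma exists_goodAt_one (hn : 0 < n) {g : Matrix (Fin n) (Fin n) ℝ} (hg : g.det = 1) {θ : ℝ}
    (hθ : 1 < θ) : ∃ h ∈ closure (AOrbit g), GoodAt 1 θ h := by
  have hθ0 : 0 < θ := by linarith
  set S : Set ℝ := {c | 0 < c ∧ ∃ h ∈ closure (AOrbit g), GoodAt c θ h} with hS
  have hne : S.Nonempty := by
    obtain ⟨c, hc, hgood⟩ := exists_latVol_ge hg
    exact ⟨c, hc, g, subset_closure (self_mem_AOrbit g), hgood.of_one hθ.le⟩
  have hbdd : BddAbove S := ⟨1, fun c ⟨_, _, _, hgood⟩ => hgood.le_one⟩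
  obtain ⟨u, hmono, hlim, huS⟩ := exists_seq_tendsto_sSup hne hbdd
  choose hu0 h hmem hgood using huS
  obtain ⟨q, hq, hqlow⟩ := exists_limit_latVol_ge hn hg
    (c := u 0 / θ ^ (n * n)) (div_pos (hu0 0) (by positivity))
    (b := fun k r => u k / θ ^ (r * (n - r))) (fun r => hlim.div_const _) hmem
    (fun k => ((hgood k).mono (hmono (Nat.zero_le k))).to_one hθ.le)
    (fun k r m hm => by rw [div_le_iff₀ (by positivity)]; exact hgood k r m hm)
  have hqgood : GoodAt (sSup S) θ q := by
    intro r m hm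
    have := hqlow r m hm
    rwa [div_le_iff₀ (by positivity)] at this
  have hspos : 0 < sSup S := (hu0 0).trans_le (hmono.ge_of_tendsto hlim 0)
  rcases lt_or_ge (sSup S) 1 with hlt | hge
  · obtain ⟨a, ha, s', hs', hgood'⟩ :=
      exists_goodAt_improvement hspos hlt hθ (det_eq_one_of_mem_closure hg hq) hqgood
    exact absurd (le_csSup hbdd ⟨hspos.trans hs', _, Apos_mul_mem_closure hq ha, hgood'⟩)
      (not_le.mpr hs')
  · exact ⟨q, hq, hqgood.mono hge⟩

lemma exists_one_le_latVol (hn : 0 < n) {g : Matrix (Fin n) (Fin n) ℝ} (hg : g.det = 1) :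
    ∃ h ∈ closure (AOrbit g), ∀ r (m : Matrix (Fin r) (Fin n) ℤ), gramDet (toReal m) ≠ 0 →
      1 ≤ latVol h m := by
  set θ : ℕ → ℝ := fun k => 1 + 1 / ((k : ℝ) + 1) with hθ
  have hθ1 : ∀ k, 1 < θ k := fun k => by
    have : 0 < 1 / ((k : ℝ) + 1) := by positivity
    simp only [hθ]; linarith
  have hθ2 : ∀ k, θ k ≤ 2 := fun k => by
    have : 1 / ((k : ℝ) + 1) ≤ 1 := by
      rw [div_le_one (by positivity)]
      have : (0 : ℝ) ≤ k := Nat.cast_nonneg k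
      linarith
    simp only [hθ]; linarith
  have hlim : Tendsto θ atTop (𝓝 1) := by
    have h := tendsto_one_div_add_atTop_nhds_zero_nat.const_add (1 : ℝ)
    rwa [add_zero] at h
  choose h hmem hgood using fun k => exists_goodAt_one hn hg (hθ1 k)
  refine exists_limit_latVol_ge hn hg (c := 1 / 2 ^ (n * n)) (by positivity)
    (b := fun k r => 1 / θ k ^ (r * (n - r))) (β := fun _ => 1) (fun r => ?_) hmem (fun k => ?_)
    (fun k r m hm => ?_)
  · have h := (tendsto_const_nhds (x := (1 : ℝ))).div (hlim.pow (r * (n - r))) (by simp)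
    rwa [one_pow, div_one] at h
  · refine ((hgood k).to_one (hθ1 k).le).mono ?_
    exact one_div_le_one_div_of_le (pow_pos (by linarith [hθ1 k]) _)
      (pow_le_pow_left₀ (by linarith [hθ1 k]) (hθ2 k) _)
  · rw [div_le_iff₀ (pow_pos (by linarith [hθ1 k]) _)]
    exact hgood k r m hm

end Maximize

/-! ### Stability of lattices given by matrices -/

section Stable

variable {n : ℕ}

/-- The parametrization of `h ℤⁿ` by `ℤⁿ`. -/
def latticeHom (h : Matrix (Fin n) (Fin n) ℝ) : (Fin n → ℤ) →+ (Fin n → ℝ) where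
  toFun z := h *ᵥ fun i => (z i : ℝ)
  map_zero' := by
    simp only [Pi.zero_apply, Int.cast_zero]
    exact mulVec_zero h
  map_add' x y := by
    rw [← mulVec_add]; congr 1; ext i; simp

lemma latticeHom_row (h : Matrix (Fin n) (Fin n) ℝ) {r : ℕ} (m : Matrix (Fin r) (Fin n) ℤ)
    (i : Fin r) : latticeHom h (m i) = (toReal m * hᵀ).row i := by
  ext k
  simp [latticeHom, mulVec, dotProduct, row, mul_apply, mul_comm]

lemma latticeOf_eq_range (h : Matrix (Fin n) (Fin n) ℝ) : latticeOf h = (latticeHom h).range := by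
  rw [latticeOf, ← AddSubgroup.closure_eq (latticeHom h).range]
  rfl

lemma gvol_row {r : ℕ} (V : Matrix (Fin r) (Fin n) ℝ) : gvol V.row = √(gramDet V) := rfl

/-- An integer basis matrix computes the covolume of the subgroup it parametrizes. -/
lemma covolSpec_of_matrix {h : Matrix (Fin n) (Fin n) ℝ} (hh : h.det ≠ 0) {r : ℕ}
    {m : Matrix (Fin r) (Fin n) ℤ} (hm : LinearIndependent ℤ m.row)
    {Λ : AddSubgroup (Fin n → ℝ)}
    (hΛ : Λ = (AddSubgroup.closure (Set.range m.row)).map (latticeHom h)) :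
    covolSpec Λ √(latVol h m) := by
  refine ⟨r, (toReal m * hᵀ).row, ?_, ?_, gvol_row _⟩
  · rw [← gramDet_ne_zero_iff]
    exact gramDet_mul_ne_zero ((gramDet_toReal_ne_zero_iff m).mpr hm) (by rwa [det_transpose])
  · rw [hΛ, AddMonoidHom.map_closure, ← Set.range_comp]
    congr 2
    ext1 i
    exact latticeHom_row h m i

lemma exists_covolSpec {h : Matrix (Fin n) (Fin n) ℝ} (hh : h.det ≠ 0)
    {Λ : AddSubgroup (Fin n → ℝ)} (hΛ : Λ ≤ latticeOf h) : ∃ c, covolSpec Λ c := by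
  obtain ⟨r, m, hm, hspan⟩ :=
    exists_basis_matrix (AddSubgroup.toIntSubmodule (Λ.comap (latticeHom h)))
  refine ⟨_, covolSpec_of_matrix hh hm ?_⟩
  rw [← Submodule.span_int_eq_addSubgroupClosure, hspan]
  rw [latticeOf_eq_range] at hΛ
  exact (AddSubgroup.map_comap_eq_self hΛ).symm

lemma one_le_of_covolSpec {h : Matrix (Fin n) (Fin n) ℝ} (hh : h.det ≠ 0)
    (hlow : ∀ r (m : Matrix (Fin r) (Fin n) ℤ), gramDet (toReal m) ≠ 0 → 1 ≤ latVol h m)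
    {Λ : AddSubgroup (Fin n → ℝ)} (hΛ : Λ ≤ latticeOf h) {c : ℝ} (hc : covolSpec Λ c) : 1 ≤ c := by
  obtain ⟨r, v, hv, hcl, rfl⟩ := hc
  rw [latticeOf_eq_range] at hΛ
  have hmem : ∀ i, ∃ z, latticeHom h z = v i := fun i =>
    hΛ (hcl ▸ AddSubgroup.subset_closure (Set.mem_range_self i))
  choose m hm using hmem
  have hV : v = (toReal (of m) * hᵀ).row := by
    ext1 i
    rw [← hm i, ← latticeHom_row]; rfl
  rw [hV, gvol_row, Real.one_le_sqrt]
  refine hlow r (of m) fun h0 => ?_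
  rw [hV, ← gramDet_ne_zero_iff] at hv
  have hu : IsUnit (hᵀ).det := by rw [det_transpose]; exact isUnit_iff_ne_zero.mpr hh
  have h1 := gramDet_mul_ne_zero hv (B := (hᵀ)⁻¹) (by
    rw [det_nonsing_inv, Ring.inverse_eq_inv']
    exact inv_ne_zero (isUnit_iff_ne_zero.mp hu))
  rw [Matrix.mul_assoc, mul_nonsing_inv _ hu, Matrix.mul_one] at h1
  exact h1 h0

lemma one_le_covol {h : Matrix (Fin n) (Fin n) ℝ} (hh : h.det ≠ 0)
    (hlow : ∀ r (m : Matrix (Fin r) (Fin n) ℤ), gramDet (toReal m) ≠ 0 → 1 ≤ latVol h m)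
    {Λ : AddSubgroup (Fin n → ℝ)} (hΛ : Λ ≤ latticeOf h) : 1 ≤ covol Λ :=
  le_csInf (exists_covolSpec hh hΛ) fun _ hc => one_le_of_covolSpec hh hlow hΛ hc

lemma closure_range_one_row :
    AddSubgroup.closure (Set.range (1 : Matrix (Fin n) (Fin n) ℤ).row) = ⊤ := by
  have h : (1 : Matrix (Fin n) (Fin n) ℤ).row = Pi.basisFun ℤ (Fin n) := by
    ext i j
    simp [row, one_apply, Pi.single_apply, eq_comm]
  rw [← Submodule.span_int_eq_addSubgroupClosure, h, (Pi.basisFun ℤ (Fin n)).span_eq]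
  rfl

lemma latticeOf_eq_closure_row (h : Matrix (Fin n) (Fin n) ℝ) :
    latticeOf h = AddSubgroup.closure (Set.range (hᵀ).row) := by
  rw [latticeOf_eq_range, AddMonoidHom.range_eq_map, ← closure_range_one_row,
    AddMonoidHom.map_closure, ← Set.range_comp]
  congr 2
  ext1 i
  have := latticeHom_row h (1 : Matrix (Fin n) (Fin n) ℤ) i
  have h1 : toReal (1 : Matrix (Fin n) (Fin n) ℤ) = 1 := by
    ext i j; simp [one_apply]
  rw [h1, Matrix.one_mul] at this
  exact this

lemma isLattice_latticeOf (hn : 0 < n) {h : Matrix (Fin n) (Fin n) ℝ} (hh : h.det ≠ 0) :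
    IsLattice (latticeOf h) := by
  have : Nonempty (Fin n) := ⟨⟨0, hn⟩⟩
  have hli : LinearIndependent ℝ (hᵀ).row :=
    linearIndependent_rows_of_det_ne_zero (A := hᵀ) (by rwa [det_transpose])
  set b := basisOfLinearIndependentOfCardEqFinrank hli (by simp) with hb
  have hbr : (b : Fin n → Fin n → ℝ) = (hᵀ).row :=
    coe_basisOfLinearIndependentOfCardEqFinrank hli _
  have hL : latticeOf h = (Submodule.span ℤ (Set.range b)).toAddSubgroup := by
    rw [latticeOf_eq_closure_row, Submodule.span_int_eq_addSubgroupClosure, hbr]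
  refine ⟨hL ▸ inferInstance, eq_top_iff.mpr ?_⟩
  rw [← b.span_eq, hL]
  exact Submodule.span_mono Submodule.subset_span

lemma covol_latticeOf {h : Matrix (Fin n) (Fin n) ℝ} (hh : h.det = 1)
    (hlow : ∀ r (m : Matrix (Fin r) (Fin n) ℤ), gramDet (toReal m) ≠ 0 → 1 ≤ latVol h m) :
    covol (latticeOf h) = 1 := by
  have hh0 : h.det ≠ 0 := by rw [hh]; exact one_ne_zero
  refine le_antisymm (csInf_le ⟨1, fun c hc => one_le_of_covolSpec hh0 hlow le_rfl hc⟩ ?_)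
    (one_le_covol hh0 hlow le_rfl)
  refine ⟨n, (hᵀ).row, linearIndependent_rows_of_det_ne_zero (A := hᵀ) (by rwa [det_transpose]),
    latticeOf_eq_closure_row h, ?_⟩
  rw [gvol_row, gramDet_square, det_transpose, hh]; simp

lemma isStable_latticeOf (hn : 0 < n) {h : Matrix (Fin n) (Fin n) ℝ} (hh : h.det = 1)
    (hlow : ∀ r (m : Matrix (Fin r) (Fin n) ℤ), gramDet (toReal m) ≠ 0 → 1 ≤ latVol h m) :
    IsStable (latticeOf h) := by
  have hh0 : h.det ≠ 0 := by rw [hh]; exact one_ne_zero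
  exact ⟨⟨isLattice_latticeOf hn hh0, covol_latticeOf hh hlow⟩,
    fun _ hΛ => one_le_covol hh0 hlow hΛ⟩

end Stable

end SW

/-- **Theorem 1.1.** For any `x ∈ ℒ_n`, the orbit closure `cl(A·x)` contains a stable lattice.
(`[h] ∈ cl(A·[g])` in `ℒ_n = SL_n(ℝ)/SL_n(ℤ)` iff `h ∈ closure (A·g·Γ)` in `SL_n(ℝ)`,
since the quotient map is open.) -/
theorem SW.stable_lattice_in_A_orbit_closure (n : ℕ) (hn : 2 ≤ n)
    (g : Matrix (Fin n) (Fin n) ℝ) (hg : g.det = 1) :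
    ∃ h : Matrix (Fin n) (Fin n) ℝ, h ∈ closure (SW.AOrbit g) ∧ SW.IsStable (SW.latticeOf h) := by
  obtain ⟨h, hmem, hlow⟩ := SW.exists_one_le_latVol (by omega) hg
  exact ⟨h, hmem, SW.isStable_latticeOf (by omega) (SW.det_eq_one_of_mem_closure hg hmem) hlow⟩
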